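/- arXiv:2003.06314 — 2 statements merged into one kernel-verified Lean document; each statement's English description precedes it below -/
import Mathlib

section
/- Let φ : A → B be a completely positive contractive order zero map between C*-algebras. Then there is a unique *-homomorphism Φ : C₀(0,1] ⊗ A → B such that Φ(id_{(0,1]} ⊗ a) = φ(a) for all a ∈ A; conversely every *-homomorphism Ψ : C₀(0,1] ⊗ A → B gives a c.p.c. order zero map a ↦ Ψ(id_{(0,1]} ⊗ a). -/
/-- A map `φ : A → B` between C*-algebras is completely positive, contractive and
order zero if it is linear, contractive, completely positive (positive matrices over `A`
are sent entrywise to positive matrices over `B`) and sends orthogonal positive elements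
to orthogonal elements. -/
structure IsCPCOrderZero {A B : Type*} [NonUnitalCStarAlgebra A] [NonUnitalCStarAlgebra B]
    [PartialOrder A] [StarOrderedRing A] [PartialOrder B] [StarOrderedRing B]
    (φ : A → B) : Prop where
  map_add : ∀ a b : A, φ (a + b) = φ a + φ b
  map_smul : ∀ (c : ℂ) (a : A), φ (c • a) = c • φ a
  contractive : ∀ a : A, ‖φ a‖ ≤ ‖a‖
  completelyPositive : ∀ (n : ℕ) (N : Matrix (Fin n) (Fin n) A),
    ∃ P : Matrix (Fin n) (Fin n) B, (N.conjTranspose * N).map φ = P.conjTranspose * P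
  orderZero : ∀ a b : A, 0 ≤ a → 0 ≤ b → a * b = 0 → φ a * φ b = 0
/-- The cone `C₀(0,1] ⊗ A`, realised concretely as the C*-algebra of continuous
functions `f : [0,1] → A` with `f 0 = 0`. -/
def cone (A : Type*) [NonUnitalCStarAlgebra A] :
    NonUnitalStarSubalgebra ℂ C(unitInterval, A) where
  carrier := {f | f 0 = 0}
  add_mem' := by intro f g hf hg; simp_all [Set.mem_setOf_eq]
  zero_mem' := by simp
  mul_mem' := by intro f g hf hg; simp_all [Set.mem_setOf_eq]
  smul_mem' := by intro c f hf; simp_all [Set.mem_setOf_eq]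
  star_mem' := by intro f hf; simp_all [Set.mem_setOf_eq]

/-- The elementary tensor `id_{(0,1]} ⊗ a`, i.e. the function `t ↦ t • a`,
as an element of the cone over `A`. -/
noncomputable def coneElem {A : Type*} [NonUnitalCStarAlgebra A] (a : A) : cone A :=
  ⟨⟨fun t => (t : ℝ) • a, by fun_prop⟩, by
    show ((0 : unitInterval) : ℝ) • a = 0
    simp⟩


namespace OZ
open Filter Topology

section Part1
variable {A B : Type*} [NonUnitalCStarAlgebra A] [NonUnitalCStarAlgebra B]
    [PartialOrder A] [StarOrderedRing A] [PartialOrder B] [StarOrderedRing B]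

theorem prod_induction {P : A → Prop} (hadd : ∀ a b, P a → P b → P (a + b))
    (hsmul : ∀ (c : ℂ) a, P a → P (c • a)) (hmul : ∀ b c, P (star b * c)) (a : A) : P a := by
  have ha : a ∈ Submodule.span ℂ {x : A | 0 ≤ x} := by
    rw [CStarAlgebra.span_nonneg]; trivial
  induction ha using Submodule.span_induction with
  | mem x hx =>
    obtain ⟨y, rfl⟩ := CStarAlgebra.nonneg_iff_eq_star_mul_self.mp hx
    exact hmul y y
  | zero => simpa using hsmul 0 _ (hmul 0 0)
  | add x y _ _ hx hy => exact hadd _ _ hx hy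
  | smul c x _ hx => exact hsmul c _ hx

theorem cp_two {φ : A → B} (hφ : IsCPCOrderZero φ) (x e : A) :
    ∃ p q r s : B, φ (star x * x) = star p * p + star q * q ∧
      φ (star e * x) = star r * p + star s * q ∧ φ (star x * e) = star p * r + star q * s := by
  obtain ⟨P, hP⟩ := hφ.completelyPositive 2 !![x, e; 0, 0]
  refine ⟨P 0 0, P 1 0, P 0 1, P 1 1, ?_, ?_, ?_⟩
  · have := congrFun (congrFun hP 0) 0
    simpa [Matrix.mul_apply, Fin.sum_univ_two, Matrix.conjTranspose_apply] using this
  · have := congrFun (congrFun hP 1) 0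
    simpa [Matrix.mul_apply, Fin.sum_univ_two, Matrix.conjTranspose_apply] using this
  · have := congrFun (congrFun hP 0) 1
    simpa [Matrix.mul_apply, Fin.sum_univ_two, Matrix.conjTranspose_apply] using this

/-- the map as a continuous linear map -/
noncomputable def toCLM {φ : A → B} (hφ : IsCPCOrderZero φ) : A →L[ℂ] B :=
  LinearMap.mkContinuous
    { toFun := φ, map_add' := hφ.map_add, map_smul' := hφ.map_smul } 1
    (by intro x; simpa using hφ.contractive x)

@[simp] theorem toCLM_apply {φ : A → B} (hφ : IsCPCOrderZero φ) (a : A) : toCLM hφ a = φ a := rfl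

theorem map_star {φ : A → B} (hφ : IsCPCOrderZero φ) (a : A) : φ (star a) = star (φ a) := by
  refine prod_induction (P := fun a => φ (star a) = star (φ a)) ?_ ?_ ?_ a
  · intro a b ha hb
    simp [hφ.map_add, ha, hb]
  · intro c a ha
    simp [hφ.map_smul, ha]
  · intro b c
    obtain ⟨p, q, r, s, h1, h2, h3⟩ := cp_two hφ c b
    simp [h2, h3]

theorem map_nonneg {φ : A → B} (hφ : IsCPCOrderZero φ) (a : A) (ha : 0 ≤ a) : 0 ≤ φ a := by
  obtain ⟨y, rfl⟩ := CStarAlgebra.nonneg_iff_eq_star_mul_self.mp ha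
  obtain ⟨p, q, r, s, h1, -, -⟩ := cp_two hφ y y
  rw [h1]
  exact add_nonneg (star_mul_self_nonneg _) (star_mul_self_nonneg _)

theorem ann_aux {φ : A → B} (hφ : IsCPCOrderZero φ) (x : A) (z : B)
    (h : φ (star x * x) * z = 0) : φ x * z = 0 := by
  have key : ∀ e : A, φ (e * x) * z = 0 := by
    intro e
    obtain ⟨p, q, r, s, h1, h2, h3⟩ := cp_two hφ x (star e)
    rw [star_star] at h2
    have h4 : star (p * z) * (p * z) + star (q * z) * (q * z) = 0 := by
      have : star z * (φ (star x * x) * z) = 0 := by rw [h, mul_zero]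
      rw [h1] at this
      rw [← this]; simp only [star_mul]; noncomm_ring
    have h5 := (add_eq_zero_iff_of_nonneg (star_mul_self_nonneg (p * z))
      (star_mul_self_nonneg (q * z))).mp h4
    have hp : p * z = 0 := CStarRing.star_mul_self_eq_zero_iff _ |>.mp h5.1
    have hq : q * z = 0 := CStarRing.star_mul_self_eq_zero_iff _ |>.mp h5.2
    rw [h2, add_mul, mul_assoc, mul_assoc, hp, hq]; simp
  have hl := CStarAlgebra.increasingApproximateUnit A
  have := hl.neBot
  have t1 : Tendsto (fun e => φ (e * x) * z) (CStarAlgebra.approximateUnit A) (𝓝 (φ x * z)) :=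
    (((toCLM hφ).continuous.tendsto x).comp (hl.tendsto_mul_right x)).mul_const z
  simp only [key] at t1
  exact tendsto_nhds_unique t1 tendsto_const_nhds

theorem oz_gen {φ : A → B} (hφ : IsCPCOrderZero φ) (x y : A) (h : x * y = 0) :
    φ x * φ y = 0 := by
  have h1 : φ (star x * x) * φ (y * star y) = 0 := by
    apply hφ.orderZero _ _ (star_mul_self_nonneg _) (mul_star_self_nonneg _)
    rw [mul_assoc, ← mul_assoc x, h]; simp
  have h2 := ann_aux hφ x _ h1
  have h3 : φ (star (star y) * star y) * star (φ x) = 0 := by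
    have := congrArg star h2
    rw [star_mul, ← map_star hφ] at this
    simpa using this
  have h4 := ann_aux hφ _ _ h3
  simpa [map_star hφ] using congrArg star h4

end Part1

section Part2
variable {A B : Type*} [NonUnitalCStarAlgebra A] [NonUnitalCStarAlgebra B]
    [PartialOrder A] [StarOrderedRing A] [PartialOrder B] [StarOrderedRing B]

theorem map_sub' {φ : A → B} (hφ : IsCPCOrderZero φ) (a b : A) : φ (a - b) = φ a - φ b :=
  map_sub (toCLM hφ) a b

theorem map_sum' {φ : A → B} (hφ : IsCPCOrderZero φ) {ι : Type*} (s : Finset ι) (g : ι → A) :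
    φ (∑ i ∈ s, g i) = ∑ i ∈ s, φ (g i) :=
  map_sum (toCLM hφ) g s

theorem step {φ : A → B} (hφ : IsCPCOrderZero φ) (R : ℕ → A)
    (hR : ∀ i j, i < j → R i * R j = R j) (hR' : ∀ i j, i < j → R j * R i = R j)
    (a c : A) (i : ℕ) :
    φ (a * R (i + 1)) * φ c - φ a * φ (R (i + 1) * c) =
      φ (a * (R (i + 1) - R (i + 2))) * φ ((R i - R (i + 1)) * c) -
      φ (a * (R i - R (i + 1))) * φ ((R (i + 1) - R (i + 2)) * c) := by
  have h1 : φ (a * R (i + 1)) * φ (c - R i * c) = 0 := by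
    apply oz_gen hφ
    rw [mul_sub, mul_assoc, mul_assoc, ← mul_assoc (R (i + 1)), hR' i (i + 1) (by omega), sub_self]
  have h2 : φ (a * R (i + 2)) * φ (R i * c - R (i + 1) * c) = 0 := by
    apply oz_gen hφ
    rw [mul_sub, mul_assoc, mul_assoc, ← mul_assoc (R (i + 2)), ← mul_assoc (R (i + 2)),
      hR' i (i + 2) (by omega), hR' (i + 1) (i + 2) (by omega), sub_self]
  have h3 : φ (a - a * R i) * φ (R (i + 1) * c) = 0 := by
    apply oz_gen hφ
    rw [sub_mul, mul_assoc, ← mul_assoc (R i), hR i (i + 1) (by omega), sub_self]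
  have h4 : φ (a * R i - a * R (i + 1)) * φ (R (i + 2) * c) = 0 := by
    apply oz_gen hφ
    rw [sub_mul, mul_assoc, mul_assoc, ← mul_assoc (R i), ← mul_assoc (R (i + 1)),
      hR i (i + 2) (by omega), hR (i + 1) (i + 2) (by omega), sub_self]
  simp only [mul_sub, sub_mul, map_sub' hφ] at h1 h2 h3 h4 ⊢
  generalize φ (a * R i) = X0 at *
  generalize φ (a * R (i + 1)) = X1 at *
  generalize φ (a * R (i + 2)) = X2 at *
  generalize φ (R i * c) = Y0 at *
  generalize φ (R (i + 1) * c) = Y1 at *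
  generalize φ (R (i + 2) * c) = Y2 at *
  generalize φ a = a' at *
  generalize φ c = c' at *
  have h : X1 * c' - a' * Y1 = (X1 * c' - a' * Y1) - (X1 * c' - X1 * Y0) - (X2 * Y0 - X2 * Y1)
    + (a' * Y1 - X0 * Y1) + (X0 * Y2 - X1 * Y2) := by
    rw [h1, h2, h3, h4]; abel
  rw [h]; abel

theorem class_sum {φ : A → B} (hφ : IsCPCOrderZero φ) (P Q : ℕ → A)
    (h : ∀ i j, i ≠ j → P i * Q j = 0) (a c : A) (m : ℕ) :
    ∑ j ∈ Finset.range m, φ (a * P j) * φ (Q j * c) =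
      φ (a * ∑ j ∈ Finset.range m, P j) * φ ((∑ j ∈ Finset.range m, Q j) * c) := by
  rw [Finset.mul_sum, Finset.sum_mul, map_sum' hφ, map_sum' hφ, Finset.sum_mul]
  refine Finset.sum_congr rfl fun i hi => ?_
  rw [Finset.mul_sum, Finset.sum_eq_single_of_mem i hi]
  intro j _ hj
  apply oz_gen hφ
  rw [mul_assoc, ← mul_assoc (P i), h i j hj.symm]; simp

theorem class_bound {φ : A → B} (hφ : IsCPCOrderZero φ) (P Q : ℕ → A)
    (h : ∀ i j, i ≠ j → P i * Q j = 0) (a c : A) (m : ℕ)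
    (hP : ‖∑ j ∈ Finset.range m, P j‖ ≤ 1) (hQ : ‖∑ j ∈ Finset.range m, Q j‖ ≤ 1) :
    ‖∑ j ∈ Finset.range m, φ (a * P j) * φ (Q j * c)‖ ≤ ‖a‖ * ‖c‖ := by
  rw [class_sum hφ P Q h]
  refine (norm_mul_le _ _).trans ?_
  gcongr
  · refine (hφ.contractive _).trans ((norm_mul_le _ _).trans ?_)
    exact mul_le_of_le_one_right (norm_nonneg _) hP
  · refine (hφ.contractive _).trans ((norm_mul_le _ _).trans ?_)
    exact mul_le_of_le_one_left (norm_nonneg _) hQ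

theorem sum_range_three {E : Type*} [AddCommMonoid E] (g : ℕ → E) (m : ℕ) :
    ∑ i ∈ Finset.range (3 * m), g i = ∑ j ∈ Finset.range m, g (3 * j) +
      ∑ j ∈ Finset.range m, g (3 * j + 1) + ∑ j ∈ Finset.range m, g (3 * j + 2) := by
  induction m with
  | zero => simp
  | succ m ih =>
    rw [show 3 * (m + 1) = 3 * m + 1 + 1 + 1 by ring, Finset.sum_range_succ, Finset.sum_range_succ,
      Finset.sum_range_succ, ih]
    simp only [Finset.sum_range_succ]
    abel

theorem discrete {φ : A → B} (hφ : IsCPCOrderZero φ) (R : ℕ → A)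
    (hR : ∀ i j, i < j → R i * R j = R j) (hR' : ∀ i j, i < j → R j * R i = R j)
    (hR0 : ‖R 0‖ ≤ 1)
    (hN : ∀ m s, ‖∑ j ∈ Finset.range m, (R (3 * j + s) - R (3 * j + s + 1))‖ ≤ 1)
    (a c : A) (m : ℕ) :
    ‖φ (a * ∑ i ∈ Finset.range (3 * m + 1), R i) * φ c -
      φ a * φ ((∑ i ∈ Finset.range (3 * m + 1), R i) * c)‖ ≤ 8 * (‖a‖ * ‖c‖) := by
  set U : ℕ → A := fun i => R i - R (i + 1) with hU
  have hUU : ∀ i j, i + 2 ≤ j → U i * U j = 0 ∧ U j * U i = 0 := by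
    intro i j hij
    simp only [hU, mul_sub, sub_mul]
    rw [hR i j (by omega), hR i (j + 1) (by omega), hR (i + 1) j (by omega),
      hR (i + 1) (j + 1) (by omega), hR' i j (by omega), hR' i (j + 1) (by omega),
      hR' (i + 1) j (by omega), hR' (i + 1) (j + 1) (by omega)]
    simp
  have hUU' : ∀ i j, i + 2 ≤ j ∨ j + 2 ≤ i → U i * U j = 0 := by
    rintro i j (h | h)
    exacts [(hUU i j h).1, (hUU j i h).2]
  have e : φ (a * ∑ i ∈ Finset.range (3 * m + 1), R i) * φ c -
      φ a * φ ((∑ i ∈ Finset.range (3 * m + 1), R i) * c) =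
      (φ (a * R 0) * φ c - φ a * φ (R 0 * c)) +
      (∑ i ∈ Finset.range (3 * m), φ (a * U (i + 1)) * φ (U i * c) -
      ∑ i ∈ Finset.range (3 * m), φ (a * U i) * φ (U (i + 1) * c)) := by
    rw [← Finset.sum_sub_distrib]
    simp only [hU]
    rw [← Finset.sum_congr rfl (fun i _ => step hφ R hR hR' a c i)]
    rw [Finset.sum_range_succ', Finset.sum_sub_distrib, mul_add, add_mul, hφ.map_add, hφ.map_add,
      Finset.mul_sum, Finset.sum_mul, map_sum' hφ, map_sum' hφ, add_mul, mul_add, Finset.mul_sum,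
      Finset.sum_mul]
    abel
  rw [e, sum_range_three, sum_range_three]
  have b0 : ‖φ (a * R 0) * φ c‖ ≤ ‖a‖ * ‖c‖ := by
    refine (norm_mul_le _ _).trans ?_
    gcongr
    · refine (hφ.contractive _).trans ((norm_mul_le _ _).trans ?_)
      exact mul_le_of_le_one_right (norm_nonneg _) hR0
    · exact hφ.contractive _
  have b0' : ‖φ a * φ (R 0 * c)‖ ≤ ‖a‖ * ‖c‖ := by
    refine (norm_mul_le _ _).trans ?_
    gcongr
    · exact hφ.contractive _
    · refine (hφ.contractive _).trans ((norm_mul_le _ _).trans ?_)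
      exact mul_le_of_le_one_left (norm_nonneg _) hR0
  have b1 : ∀ s, ‖∑ j ∈ Finset.range m, φ (a * U (3 * j + s + 1)) * φ (U (3 * j + s) * c)‖
      ≤ ‖a‖ * ‖c‖ := by
    intro s
    apply class_bound hφ (fun j => U (3 * j + s + 1)) (fun j => U (3 * j + s))
    · intro i j hij
      exact hUU' _ _ (by omega)
    · exact hN m (s + 1)
    · exact hN m s
  have b2 : ∀ s, ‖∑ j ∈ Finset.range m, φ (a * U (3 * j + s)) * φ (U (3 * j + s + 1) * c)‖
      ≤ ‖a‖ * ‖c‖ := by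
    intro s
    apply class_bound hφ (fun j => U (3 * j + s)) (fun j => U (3 * j + s + 1))
    · intro i j hij
      exact hUU' _ _ (by omega)
    · exact hN m s
    · exact hN m (s + 1)
  have c0 := b1 0
  have c1 := b1 1
  have c2 := b1 2
  have d0 := b2 0
  have d1 := b2 1
  have d2 := b2 2
  simp only [add_zero] at c0 d0
  refine (norm_add_le _ _).trans ?_
  refine (add_le_add (norm_sub_le _ _) ((norm_sub_le _ _).trans
    (add_le_add (norm_add₃_le) (norm_add₃_le)))).trans ?_
  linarith

/-- ramp function -/
noncomputable def ramp (n : ℝ) (i : ℕ) (t : ℝ) : ℝ := max 0 (min 1 (n * t - i))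

theorem ramp_cont (n : ℝ) (i : ℕ) : Continuous (ramp n i) := by
  unfold ramp; fun_prop

theorem ramp_zero (n : ℝ) (i : ℕ) : ramp n i 0 = 0 := by
  simp [ramp]

theorem ramp_nonneg (n : ℝ) (i : ℕ) (t : ℝ) : 0 ≤ ramp n i t := le_max_left _ _

theorem ramp_le_one (n : ℝ) (i : ℕ) (t : ℝ) : ramp n i t ≤ 1 := by
  simp [ramp]

theorem ramp_anti (n : ℝ) {i j : ℕ} (h : i ≤ j) (t : ℝ) : ramp n j t ≤ ramp n i t := by
  have : (i : ℝ) ≤ j := by exact_mod_cast h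
  unfold ramp
  gcongr

theorem ramp_mul (n : ℝ) {i j : ℕ} (h : i < j) (t : ℝ) : ramp n i t * ramp n j t = ramp n j t := by
  have : (i : ℝ) + 1 ≤ j := by exact_mod_cast h
  rcases le_total (n * t - j) 0 with h1 | h1
  · have : ramp n j t = 0 := max_eq_left ((min_le_right _ _).trans h1)
    simp [this]
  · have : ramp n i t = 1 := by
      unfold ramp
      rw [min_eq_left (by linarith)]; simp
    simp [this]

theorem ramp_sum (n : ℝ) (M : ℕ) (t : ℝ) :
    ∑ i ∈ Finset.range M, ramp n i t = max 0 (min (M : ℝ) (n * t)) := by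
  induction M with
  | zero => simp
  | succ M ih =>
    rw [Finset.sum_range_succ, ih]
    unfold ramp
    push_cast
    have : (0 : ℝ) ≤ M := by positivity
    rcases max_cases 0 (min (M : ℝ) (n * t)) with h | h <;>
    rcases min_cases (M : ℝ) (n * t) with h' | h' <;>
    rcases max_cases 0 (min (1 : ℝ) (n * t - M)) with h'' | h'' <;>
    rcases min_cases (1 : ℝ) (n * t - M) with h3 | h3 <;>
    rcases max_cases 0 (min (M + 1 : ℝ) (n * t)) with h4 | h4 <;>
    rcases min_cases (M + 1 : ℝ) (n * t) with h5 | h5 <;> linarith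

theorem ramp_tents (n : ℝ) (m s : ℕ) (t : ℝ) :
    |∑ j ∈ Finset.range m, (ramp n (3 * j + s) t - ramp n (3 * j + s + 1) t)| ≤ 1 := by
  have h0 : 0 ≤ ∑ j ∈ Finset.range m, (ramp n (3 * j + s) t - ramp n (3 * j + s + 1) t) :=
    Finset.sum_nonneg fun j _ => sub_nonneg.mpr (ramp_anti n (by omega) t)
  have h1 : ∑ j ∈ Finset.range m, (ramp n (3 * j + s) t - ramp n (3 * j + s + 1) t) ≤
      ∑ j ∈ Finset.range m, (ramp n (3 * j + s) t - ramp n (3 * (j + 1) + s) t) := by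
    gcongr with j _
    exact ramp_anti n (by omega) t
  rw [Finset.sum_range_sub' (fun j => ramp n (3 * j + s) t)] at h1
  rw [abs_of_nonneg h0]
  linarith [ramp_le_one n (3 * 0 + s) t, ramp_nonneg n (3 * m + s) t]

theorem key_nonneg {φ : A → B} (hφ : IsCPCOrderZero φ) (a b c : A) (hb : 0 ≤ b) :
    φ (a * b) * φ c = φ a * φ (b * c) := by
  have hsa : IsSelfAdjoint b := .of_nonneg hb
  have main : ∀ n : ℕ, n * ‖φ (a * b) * φ c - φ a * φ (b * c)‖ ≤ 8 * (‖a‖ * ‖c‖) := by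
    intro n
    obtain ⟨m, hm⟩ := exists_nat_ge (n * ‖b‖)
    let R : ℕ → A := fun i => cfcₙ (ramp n i) b
    have hcont : ∀ i, ContinuousOn (ramp n i) (quasispectrum ℝ b) := fun i =>
      (ramp_cont n i).continuousOn
    have hR : ∀ i j, i < j → R i * R j = R j := by
      intro i j hij
      simp only [R]
      rw [← cfcₙ_mul _ _ b (hcont i) (ramp_zero _ _) (hcont j) (ramp_zero _ _)]
      simp only [ramp_mul _ hij]
    have hR' : ∀ i j, i < j → R j * R i = R j := by
      intro i j hij
      simp only [R]
      rw [← cfcₙ_mul _ _ b (hcont j) (ramp_zero _ _) (hcont i) (ramp_zero _ _)]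
      simp only [mul_comm (ramp n j _), ramp_mul _ hij]
    have hR0 : ‖R 0‖ ≤ 1 := norm_cfcₙ_le fun x _ => by
      rw [Real.norm_of_nonneg (ramp_nonneg _ _ _)]; exact ramp_le_one _ _ _
    have hN : ∀ m s, ‖∑ j ∈ Finset.range m, (R (3 * j + s) - R (3 * j + s + 1))‖ ≤ 1 := by
      intro m s
      have : ∑ j ∈ Finset.range m, (R (3 * j + s) - R (3 * j + s + 1)) =
          cfcₙ (∑ j ∈ Finset.range m,
            (fun t => ramp n (3 * j + s) t - ramp n (3 * j + s + 1) t)) b := by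
        rw [cfcₙ_sum (fun j t => ramp n (3 * j + s) t - ramp n (3 * j + s + 1) t) b _
          (fun j _ => (hcont _).sub (hcont _)) (fun j _ => by simp [ramp_zero])]
        refine Finset.sum_congr rfl fun j _ => ?_
        rw [cfcₙ_sub _ _ b (hcont _) (ramp_zero _ _) (hcont _) (ramp_zero _ _)]
      rw [this]
      refine norm_cfcₙ_le fun x _ => ?_
      rw [Finset.sum_apply]
      exact ramp_tents n m s x
    have hS : ∑ i ∈ Finset.range (3 * m + 1), R i = (n : ℝ) • b := by
      simp only [R]
      rw [← cfcₙ_sum _ _ _ (fun i _ => hcont i) (fun i _ => ramp_zero _ _)]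
      conv_rhs => rw [← cfcₙ_id' ℝ b]
      rw [← cfcₙ_smul _ _ b]
      refine cfcₙ_congr fun t ht => ?_
      have ht0 : 0 ≤ t := quasispectrum_nonneg_of_nonneg b hb t ht
      have ht1 : t ≤ ‖b‖ := by
        have := norm_apply_le_norm_cfcₙ (fun x : ℝ => x) b ht
        rw [cfcₙ_id' ℝ b] at this
        exact (le_abs_self t).trans this
      have h2 : (n : ℝ) * t ≤ m := (mul_le_mul_of_nonneg_left ht1 (by positivity)).trans hm
      have h3 : (0 : ℝ) ≤ m := by positivity
      rw [Finset.sum_apply, ramp_sum, smul_eq_mul, min_eq_right (by push_cast; linarith),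
        max_eq_right (by positivity)]
    have h := discrete hφ R hR hR' hR0 hN a c m
    rw [hS] at h
    have e : ((n : ℝ) • b) = (n : ℂ) • b := by
      rw [← Complex.coe_smul]; simp
    rw [e, mul_smul_comm, smul_mul_assoc, hφ.map_smul, hφ.map_smul, smul_mul_assoc,
      mul_smul_comm, ← smul_sub, norm_smul] at h
    simpa using h
  by_contra hne
  have hpos : 0 < ‖φ (a * b) * φ c - φ a * φ (b * c)‖ := norm_pos_iff.mpr (sub_ne_zero.mpr hne)
  obtain ⟨n, hn⟩ := exists_nat_gt (8 * (‖a‖ * ‖c‖) / ‖φ (a * b) * φ c - φ a * φ (b * c)‖)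
  rw [div_lt_iff₀ hpos] at hn
  exact absurd (main n) (not_le.mpr hn)

theorem key {φ : A → B} (hφ : IsCPCOrderZero φ) (a b c : A) :
    φ (a * b) * φ c = φ a * φ (b * c) := by
  have ha : b ∈ Submodule.span ℂ {x : A | 0 ≤ x} := by
    rw [CStarAlgebra.span_nonneg]; trivial
  induction ha using Submodule.span_induction with
  | mem x hx => exact key_nonneg hφ a x c hx
  | zero =>
    have : φ 0 = 0 := map_zero (toCLM hφ)
    simp [this]
  | add x y _ _ hx hy => simp only [mul_add, add_mul, hφ.map_add, hx, hy]
  | smul r x _ hx =>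
    simp only [mul_smul_comm, smul_mul_assoc, hφ.map_smul, hx]

end Part2

section Part3
variable {A B : Type*} [NonUnitalCStarAlgebra A] [NonUnitalCStarAlgebra B]
    [PartialOrder A] [StarOrderedRing A] [PartialOrder B] [StarOrderedRing B]

theorem closed_conv {ι E F : Type*} [PseudoMetricSpace E] [MetricSpace F] [CompleteSpace F]
    (l : Filter ι) [l.NeBot] (G : ι → E → F)
    (hG : ∀ᶠ e in l, ∀ x x', dist (G e x) (G e x') ≤ dist x x') (D : Set F) (hD : IsClosed D) :
    IsClosed {x | ∃ y ∈ D, Tendsto (fun e => G e x) l (𝓝 y)} := by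
  refine isClosed_of_closure_subset fun x hx => ?_
  obtain ⟨u, hu, hux⟩ := mem_closure_iff_seq_limit.mp hx
  choose y hyD hy using hu
  have hd : ∀ n m, dist (y n) (y m) ≤ dist (u n) (u m) := by
    intro n m
    refine le_of_tendsto ((hy n).dist (hy m)) ?_
    filter_upwards [hG] with e he
    exact he _ _
  have hc : CauchySeq y := by
    have hcu := hux.cauchySeq
    rw [Metric.cauchySeq_iff] at hcu ⊢
    intro ε hε
    obtain ⟨N, hN⟩ := hcu ε hε
    exact ⟨N, fun m hm n hn => (hd m n).trans_lt (hN m hm n hn)⟩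
  obtain ⟨z, hz⟩ := cauchySeq_tendsto_of_complete hc
  refine ⟨z, hD.mem_of_tendsto hz (Eventually.of_forall hyD), ?_⟩
  rw [Metric.tendsto_nhds]
  intro ε hε
  obtain ⟨n, hn1, hn2⟩ := ((Metric.tendsto_nhds.mp hux (ε / 3) (by positivity)).and
    (Metric.tendsto_nhds.mp hz (ε / 3) (by positivity))).exists
  filter_upwards [hG, Metric.tendsto_nhds.mp (hy n) (ε / 3) (by positivity)] with e h1 h2
  have h3 := h1 x (u n)
  rw [dist_comm x] at h3
  have h4 := dist_triangle4 (G e x) (G e (u n)) (y n) z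
  linarith

/-- convergence of left and right products with the approximate unit -/
def Conv (φ : A → B) (x y : B) : Prop :=
  Tendsto (fun e => φ e * x) (CStarAlgebra.approximateUnit A) (𝓝 y) ∧
  Tendsto (fun e => x * φ e) (CStarAlgebra.approximateUnit A) (𝓝 y)

instance : (CStarAlgebra.approximateUnit A).NeBot :=
  (CStarAlgebra.increasingApproximateUnit A).neBot

theorem Conv.unique {φ : A → B} {x y y' : B} (h : Conv φ x y) (h' : Conv φ x y') : y = y' :=
  tendsto_nhds_unique h.1 h'.1

theorem Conv.add {φ : A → B} {x y x' y' : B} (h : Conv φ x y) (h' : Conv φ x' y') :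
    Conv φ (x + x') (y + y') :=
  ⟨by simpa [mul_add] using h.1.add h'.1, by simpa [add_mul] using h.2.add h'.2⟩

theorem Conv.smul {φ : A → B} {x y : B} (c : ℂ) (h : Conv φ x y) :
    Conv φ (c • x) (c • y) :=
  ⟨by simpa [mul_smul_comm] using h.1.const_smul c,
   by simpa [smul_mul_assoc] using h.2.const_smul c⟩

theorem Conv.mul_left {φ : A → B} {x y x' y' : B} (h : Conv φ x y) (h' : Conv φ x' y') :
    y * x' = x * y' := by
  have h1 : Tendsto (fun e => x * φ e * x') (CStarAlgebra.approximateUnit A) (𝓝 (y * x')) :=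
    h.2.mul_const x'
  have h2 : Tendsto (fun e => x * φ e * x') (CStarAlgebra.approximateUnit A) (𝓝 (x * y')) := by
    simpa [mul_assoc] using h'.1.const_mul x
  exact tendsto_nhds_unique h1 h2

theorem Conv.mul {φ : A → B} {x y x' y' : B} (h : Conv φ x y) (h' : Conv φ x' y') :
    Conv φ (x * x') (y * x') := by
  constructor
  · simpa [mul_assoc] using h.1.mul_const x'
  · rw [h.mul_left h']
    simpa [mul_assoc] using h'.2.const_mul x

theorem Conv.star {φ : A → B} (hφ : IsCPCOrderZero φ) {x y : B} (h : Conv φ x y) :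
    Conv φ (star x) (star y) := by
  have hs := (CStarAlgebra.increasingApproximateUnit A).eventually_star_eq
  constructor
  · refine ((continuous_star.tendsto y).comp h.2).congr' ?_
    filter_upwards [hs] with e he
    simp [← map_star hφ, he]
  · refine ((continuous_star.tendsto y).comp h.1).congr' ?_
    filter_upwards [hs] with e he
    simp [← map_star hφ, he]

/-- the subalgebra on which the multiplier acts -/
def SS {φ : A → B} (hφ : IsCPCOrderZero φ) : NonUnitalStarSubalgebra ℂ B where
  carrier := {x | ∃ y, Conv φ x y}
  add_mem' := by rintro a b ⟨y, hy⟩ ⟨z, hz⟩; exact ⟨_, hy.add hz⟩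
  zero_mem' := ⟨0, by simp [Conv]⟩
  mul_mem' := by rintro a b ⟨y, hy⟩ ⟨z, hz⟩; exact ⟨_, hy.mul hz⟩
  smul_mem' := by rintro c x ⟨y, hy⟩; exact ⟨_, hy.smul c⟩
  star_mem' := by rintro x ⟨y, hy⟩; exact ⟨_, hy.star hφ⟩

theorem mem_SS {φ : A → B} (hφ : IsCPCOrderZero φ) {x : B} : x ∈ SS hφ ↔ ∃ y, Conv φ x y := Iff.rfl

theorem eventually_norm_le {φ : A → B} (hφ : IsCPCOrderZero φ) :
    ∀ᶠ e in CStarAlgebra.approximateUnit A, ‖φ e‖ ≤ 1 := by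
  filter_upwards [(CStarAlgebra.increasingApproximateUnit A).eventually_norm] with e he
  exact (hφ.contractive e).trans he

theorem isClosed_SS {φ : A → B} (hφ : IsCPCOrderZero φ) : IsClosed (SS hφ : Set B) := by
  have h := closed_conv (E := B) (CStarAlgebra.approximateUnit A)
    (fun (e : A) (x : B) => (φ e * x, x * φ e)) (by
      filter_upwards [eventually_norm_le hφ] with e he x x'
      rw [Prod.dist_eq, dist_eq_norm, dist_eq_norm, dist_eq_norm]
      simp only [← mul_sub, ← sub_mul]
      refine max_le ?_ ?_
      · exact (norm_mul_le _ _).trans (mul_le_of_le_one_left (norm_nonneg _) he)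
      · exact (norm_mul_le _ _).trans (mul_le_of_le_one_right (norm_nonneg _) he))
    (Set.diagonal B) isClosed_diagonal
  convert h using 1
  ext x
  constructor
  · rintro ⟨y, hy⟩
    exact ⟨(y, y), rfl, hy.1.prodMk_nhds hy.2⟩
  · rintro ⟨⟨y, z⟩, hyz, hy⟩
    obtain rfl : y = z := hyz
    exact ⟨y, (Prod.tendsto_iff _ _).mp hy⟩

theorem conv_map_mul {φ : A → B} (hφ : IsCPCOrderZero φ) (a b : A) :
    Conv φ (φ (a * b)) (φ a * φ b) := by
  have hl := CStarAlgebra.increasingApproximateUnit A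
  constructor
  · simp only [← key hφ]
    exact (((toCLM hφ).continuous.tendsto a).comp (hl.tendsto_mul_right a)).mul_const _
  · simp only [key hφ]
    exact (((toCLM hφ).continuous.tendsto b).comp (hl.tendsto_mul_left b)).const_mul _

theorem map_mem_SS {φ : A → B} (hφ : IsCPCOrderZero φ) (a : A) : φ a ∈ SS hφ := by
  refine prod_induction (P := fun a => φ a ∈ SS hφ) ?_ ?_ ?_ a
  · intro a b ha hb
    rw [hφ.map_add]; exact add_mem ha hb
  · intro c a ha
    rw [hφ.map_smul]; exact SMulMemClass.smul_mem c ha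
  · intro b c
    exact ⟨_, conv_map_mul hφ _ _⟩

theorem Conv.mem {φ : A → B} (hφ : IsCPCOrderZero φ) {x y : B} (h : Conv φ x y) : y ∈ SS hφ := by
  refine (isClosed_SS hφ).mem_of_tendsto h.1 (Eventually.of_forall fun e => ?_)
  exact mul_mem (map_mem_SS hφ e) ⟨y, h⟩

theorem Conv.norm_le {φ : A → B} (hφ : IsCPCOrderZero φ) {x y : B} (h : Conv φ x y) :
    ‖y‖ ≤ ‖x‖ := by
  refine le_of_tendsto h.1.norm ?_
  filter_upwards [eventually_norm_le hφ] with e he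
  exact (norm_mul_le _ _).trans (mul_le_of_le_one_left (norm_nonneg _) he)

/-- the multiplier -/
noncomputable def TT {φ : A → B} (hφ : IsCPCOrderZero φ) : SS hφ →ₗ[ℂ] SS hφ where
  toFun x := ⟨x.2.choose, x.2.choose_spec.mem hφ⟩
  map_add' x y := by
    apply Subtype.ext
    exact (x + y).2.choose_spec.unique (x.2.choose_spec.add y.2.choose_spec)
  map_smul' c x := by
    apply Subtype.ext
    exact (c • x).2.choose_spec.unique (x.2.choose_spec.smul c)

theorem conv_TT {φ : A → B} (hφ : IsCPCOrderZero φ) (x : SS hφ) : Conv φ x (TT hφ x) :=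
  x.2.choose_spec

theorem TT_mul {φ : A → B} (hφ : IsCPCOrderZero φ) (x y : SS hφ) :
    TT hφ (x * y) = TT hφ x * y :=
  Subtype.ext ((conv_TT hφ (x * y)).unique ((conv_TT hφ x).mul (conv_TT hφ y)))

theorem TT_mul' {φ : A → B} (hφ : IsCPCOrderZero φ) (x y : SS hφ) :
    TT hφ (x * y) = x * TT hφ y := by
  rw [TT_mul]
  exact Subtype.ext ((conv_TT hφ x).mul_left (conv_TT hφ y))

theorem TT_star {φ : A → B} (hφ : IsCPCOrderZero φ) (x : SS hφ) :
    TT hφ (star x) = star (TT hφ x) :=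
  Subtype.ext ((conv_TT hφ (star x)).unique ((conv_TT hφ x).star hφ))

theorem TT_norm {φ : A → B} (hφ : IsCPCOrderZero φ) (x : SS hφ) : ‖TT hφ x‖ ≤ ‖x‖ :=
  (conv_TT hφ x).norm_le hφ

/-- the corestriction of the order zero map -/
noncomputable def PP {φ : A → B} (hφ : IsCPCOrderZero φ) : A →ₗ[ℂ] SS hφ where
  toFun a := ⟨φ a, map_mem_SS hφ a⟩
  map_add' a b := Subtype.ext (hφ.map_add a b)
  map_smul' c a := Subtype.ext (hφ.map_smul c a)

@[simp] theorem coe_PP {φ : A → B} (hφ : IsCPCOrderZero φ) (a : A) : (PP hφ a : B) = φ a := rfl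

theorem PP_mul {φ : A → B} (hφ : IsCPCOrderZero φ) (a b : A) :
    PP hφ a * PP hφ b = TT hφ (PP hφ (a * b)) :=
  Subtype.ext ((conv_map_mul hφ a b).unique (conv_TT hφ (PP hφ (a * b))))

theorem SS_sqrt {φ : A → B} (hφ : IsCPCOrderZero φ) (x : SS hφ) (hx : 0 ≤ (x : B)) :
    ∃ y : SS hφ, x = star y * y := by
  have := isClosed_SS hφ
  have hsa : IsSelfAdjoint (x : B) := .of_nonneg hx
  have hs : IsSelfAdjoint (cfcₙ Real.sqrt (x : B)) := cfcₙ_predicate _ _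
  refine ⟨⟨cfcₙ Real.sqrt (x : B), cfcₙ_mem (𝕜' := ℂ) (s := SS hφ) _ x.2⟩, Subtype.ext ?_⟩
  show (x : B) = star (cfcₙ Real.sqrt (x : B)) * cfcₙ Real.sqrt (x : B)
  rw [hs.star_eq, ← cfcₙ_mul _ _ _]
  conv_lhs => rw [← cfcₙ_id' ℝ (x : B)]
  refine cfcₙ_congr fun t ht => ?_
  exact (Real.mul_self_sqrt (quasispectrum_nonneg_of_nonneg _ hx t ht)).symm

theorem TT_nonneg {φ : A → B} (hφ : IsCPCOrderZero φ) (x : SS hφ) (hx : 0 ≤ (x : B)) :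
    0 ≤ (TT hφ x : B) := by
  obtain ⟨y, rfl⟩ := SS_sqrt hφ x hx
  rw [TT_mul']
  refine CStarAlgebra.isClosed_nonneg.mem_of_tendsto
    ((conv_TT hφ y).1.const_mul (star (y : B))) ?_
  filter_upwards [(CStarAlgebra.increasingApproximateUnit A).eventually_nonneg] with e he
  show 0 ≤ star (y : B) * (φ e * y)
  rw [← mul_assoc]
  exact star_left_conjugate_nonneg (map_nonneg hφ e he) _

theorem TT_le {φ : A → B} (hφ : IsCPCOrderZero φ) (x : SS hφ) (hx : 0 ≤ (x : B)) :
    0 ≤ ((x - TT hφ x : SS hφ) : B) := by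
  obtain ⟨y, rfl⟩ := SS_sqrt hφ x hx
  rw [TT_mul']
  refine CStarAlgebra.isClosed_nonneg.mem_of_tendsto
    (((conv_TT hφ y).1.const_mul (star (y : B))).const_sub (star (y : B) * y)) ?_
  filter_upwards [(CStarAlgebra.increasingApproximateUnit A).eventually_nonneg,
    eventually_norm_le hφ] with e he he'
  show 0 ≤ star (y : B) * y - star (y : B) * (φ e * y)
  rw [← mul_assoc, sub_nonneg]
  have hsa : IsSelfAdjoint (φ e) := .of_nonneg (map_nonneg hφ e he)
  refine (CStarAlgebra.star_left_conjugate_le_norm_smul (a := (y : B)) (b := φ e)).trans ?_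
  exact smul_le_of_le_one_left (star_mul_self_nonneg _) he'

end Part3

section Part4
open Polynomial
variable {A B : Type*} [NonUnitalCStarAlgebra A] [NonUnitalCStarAlgebra B]
    [PartialOrder A] [StarOrderedRing A] [PartialOrder B] [StarOrderedRing B]

/-- polynomial functional calculus of the multiplier -/
noncomputable def ev {φ : A → B} (hφ : IsCPCOrderZero φ) : ℂ[X] →ₐ[ℂ] Module.End ℂ (SS hφ) :=
  aeval (TT hφ)

theorem ev_X {φ : A → B} (hφ : IsCPCOrderZero φ) (x : SS hφ) : ev hφ X x = TT hφ x := by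
  simp [ev]

theorem ev_mul {φ : A → B} (hφ : IsCPCOrderZero φ) (p q : ℂ[X]) (x : SS hφ) :
    ev hφ (p * q) x = ev hφ p (ev hφ q x) := by
  simp [map_mul]

theorem ev_mul_left {φ : A → B} (hφ : IsCPCOrderZero φ) (p : ℂ[X]) (x y : SS hφ) :
    ev hφ p (x * y) = ev hφ p x * y := by
  induction p using Polynomial.induction_on' generalizing x y with
  | add p q hp hq => simp [hp, hq, add_mul]
  | monomial n c =>
    simp only [ev, aeval_monomial, Module.End.mul_apply, Module.algebraMap_end_apply,
      smul_mul_assoc]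
    congr 1
    induction n with
    | zero => simp
    | succ n ih => rw [pow_succ', Module.End.mul_apply, Module.End.mul_apply, ih, TT_mul]

theorem ev_mul_right {φ : A → B} (hφ : IsCPCOrderZero φ) (p : ℂ[X]) (x y : SS hφ) :
    ev hφ p (x * y) = x * ev hφ p y := by
  induction p using Polynomial.induction_on' generalizing x y with
  | add p q hp hq => simp [hp, hq, mul_add]
  | monomial n c =>
    simp only [ev, aeval_monomial, Module.End.mul_apply, Module.algebraMap_end_apply,
      mul_smul_comm]
    congr 1
    induction n with
    | zero => simp
    | succ n ih => rw [pow_succ', Module.End.mul_apply, Module.End.mul_apply, ih, TT_mul']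

theorem ev_bdd {φ : A → B} (hφ : IsCPCOrderZero φ) (p : ℂ[X]) :
    ∃ C : ℝ, ∀ x : SS hφ, ‖ev hφ p x‖ ≤ C * ‖x‖ := by
  induction p using Polynomial.induction_on' with
  | add p q hp hq =>
    obtain ⟨C, hC⟩ := hp
    obtain ⟨D, hD⟩ := hq
    refine ⟨C + D, fun x => ?_⟩
    rw [map_add, LinearMap.add_apply, add_mul]
    exact (norm_add_le _ _).trans (add_le_add (hC x) (hD x))
  | monomial n c =>
    refine ⟨‖c‖, fun x => ?_⟩
    simp only [ev, aeval_monomial, Module.End.mul_apply, Module.algebraMap_end_apply]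
    rw [norm_smul]
    gcongr
    induction n with
    | zero => simp
    | succ n ih => rw [pow_succ', Module.End.mul_apply]; exact (TT_norm hφ _).trans ih

/-- polynomials acting as positive, star preserving maps -/
structure Good {φ : A → B} (hφ : IsCPCOrderZero φ) (p : ℂ[X]) : Prop where
  pos : ∀ x : SS hφ, 0 ≤ (x : B) → 0 ≤ (ev hφ p x : B)
  star : ∀ x : SS hφ, star (ev hφ p x) = ev hφ p (star x)

theorem Good.mul {φ : A → B} {hφ : IsCPCOrderZero φ} {p q : ℂ[X]} (hp : Good hφ p)
    (hq : Good hφ q) : Good hφ (p * q) where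
  pos x hx := by rw [ev_mul]; exact hp.pos _ (hq.pos _ hx)
  star x := by rw [ev_mul, ev_mul, hp.star, hq.star]

theorem Good.one {φ : A → B} (hφ : IsCPCOrderZero φ) : Good hφ 1 where
  pos x hx := by simpa using hx
  star x := by simp

theorem Good.zero {φ : A → B} (hφ : IsCPCOrderZero φ) : Good hφ 0 where
  pos x hx := by simp
  star x := by simp

theorem Good.pow {φ : A → B} {hφ : IsCPCOrderZero φ} {p : ℂ[X]} (hp : Good hφ p) (n : ℕ) :
    Good hφ (p ^ n) := by
  induction n with
  | zero => simpa using Good.one hφ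
  | succ n ih => rw [pow_succ]; exact ih.mul hp

theorem Good.add {φ : A → B} {hφ : IsCPCOrderZero φ} {p q : ℂ[X]} (hp : Good hφ p)
    (hq : Good hφ q) : Good hφ (p + q) where
  pos x hx := by
    rw [map_add, LinearMap.add_apply]
    exact add_nonneg (hp.pos _ hx) (hq.pos _ hx)
  star x := by simp [hp.star, hq.star]

theorem Good.natCast {φ : A → B} (hφ : IsCPCOrderZero φ) (n : ℕ) : Good hφ (n : ℂ[X]) := by
  induction n with
  | zero => simpa using Good.zero hφ
  | succ n ih => push_cast; exact ih.add (Good.one hφ)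

theorem Good.X {φ : A → B} (hφ : IsCPCOrderZero φ) : Good hφ X where
  pos x hx := by rw [ev_X]; exact TT_nonneg hφ x hx
  star x := by rw [ev_X, ev_X, TT_star]

theorem Good.one_sub_X {φ : A → B} (hφ : IsCPCOrderZero φ) : Good hφ (1 - Polynomial.X) where
  pos x hx := by
    rw [map_sub, LinearMap.sub_apply, ev_X, map_one]; exact TT_le hφ x hx
  star x := by
    rw [map_sub, LinearMap.sub_apply, LinearMap.sub_apply, ev_X, ev_X, map_one, star_sub, TT_star]
    rfl

section est
variable {ι : Type*} (s : Finset ι) (Q : ι → ℂ[X])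

/-- the approximating sums -/
noncomputable def xx {φ : A → B} (hφ : IsCPCOrderZero φ) (a : ι → A) : SS hφ :=
  ∑ k ∈ s, ev hφ (Q k) (PP hφ (a k))

theorem PP_star {φ : A → B} (hφ : IsCPCOrderZero φ) (a : A) :
    star (PP hφ a) = PP hφ (star a) := by
  apply Subtype.ext
  simp [map_star hφ]

theorem star_xx_mul {φ : A → B} (hφ : IsCPCOrderZero φ) (hQ : ∀ k ∈ s, Good hφ (Q k))
    (a : ι → A) : star (xx s Q hφ a) * xx s Q hφ a =
      ∑ j ∈ s, ∑ k ∈ s, ev hφ (Q j * Q k * X) (PP hφ (star (a j) * a k)) := by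
  simp only [xx, star_sum, Finset.sum_mul_sum]
  refine Finset.sum_congr rfl fun j hj => Finset.sum_congr rfl fun k hk => ?_
  rw [(hQ j hj).star, PP_star, ← ev_mul_left, ← ev_mul_right, PP_mul, ← ev_X, ← ev_mul,
    ← ev_mul]

theorem xx_le {φ : A → B} (hφ : IsCPCOrderZero φ) (hQ : ∀ k ∈ s, Good hφ (Q k))
    (hQ1 : Good hφ (1 - ∑ k ∈ s, X * Q k)) (a : ι → A) :
    ((star (xx s Q hφ a) * xx s Q hφ a : SS hφ) : B) ≤
      (xx s Q hφ (fun k => star (a k) * a k) : B) := by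
  have hR : ∀ j ∈ s, ∀ k ∈ s, Good hφ (Q j * Q k * X) :=
    fun j hj k hk => ((hQ j hj).mul (hQ k hk)).mul (Good.X hφ)
  have hP : ∀ a : A, 0 ≤ (PP hφ (star a * a) : B) := fun a =>
    map_nonneg hφ _ (star_mul_self_nonneg a)
  set S1 : SS hφ := ∑ j ∈ s, ∑ k ∈ s, ev hφ (Q j * Q k * X) (PP hφ (star (a j) * a k)) with hS1
  set S2 : SS hφ := ∑ j ∈ s, ∑ k ∈ s, ev hφ (Q j * Q k * X) (PP hφ (star (a k) * a k)) with hS2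
  have h0 : 0 ≤ ((∑ j ∈ s, ∑ k ∈ s, ev hφ (Q j * Q k * X)
      (PP hφ (star (a j - a k) * (a j - a k))) : SS hφ) : B) := by
    rw [AddSubmonoidClass.coe_finsetSum]
    refine Finset.sum_nonneg fun j hj => ?_
    rw [AddSubmonoidClass.coe_finsetSum]
    refine Finset.sum_nonneg fun k hk => ?_
    exact (hR j hj k hk).pos _ (hP _)
  have h1 : (∑ j ∈ s, ∑ k ∈ s, ev hφ (Q j * Q k * X)
      (PP hφ (star (a j - a k) * (a j - a k))) : SS hφ) = (S2 - S1) + (S2 - S1) := by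
    have e1 : S1 = ∑ j ∈ s, ∑ k ∈ s, ev hφ (Q j * Q k * X) (PP hφ (star (a k) * a j)) := by
      rw [hS1, Finset.sum_comm]
      refine Finset.sum_congr rfl fun j hj => Finset.sum_congr rfl fun k hk => ?_
      rw [mul_comm (Q k)]
    have e2 : S2 = ∑ j ∈ s, ∑ k ∈ s, ev hφ (Q j * Q k * X) (PP hφ (star (a j) * a j)) := by
      rw [hS2, Finset.sum_comm]
      refine Finset.sum_congr rfl fun j hj => Finset.sum_congr rfl fun k hk => ?_
      rw [mul_comm (Q k)]
    have e3 : (S2 - S1) + (S2 - S1) = ∑ j ∈ s, ∑ k ∈ s,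
       ((ev hφ (Q j * Q k * X) (PP hφ (star (a k) * a k)) -
         ev hφ (Q j * Q k * X) (PP hφ (star (a j) * a k))) +
        (ev hφ (Q j * Q k * X) (PP hφ (star (a j) * a j)) -
         ev hφ (Q j * Q k * X) (PP hφ (star (a k) * a j)))) := by
      simp only [Finset.sum_add_distrib, Finset.sum_sub_distrib]
      rw [← e1, ← e2]
    rw [e3]
    refine Finset.sum_congr rfl fun j hj => Finset.sum_congr rfl fun k hk => ?_
    rw [← map_sub, ← map_sub, ← map_sub, ← map_sub, ← map_add, ← map_add]
    congr 2
    rw [star_sub]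
    noncomm_ring
  have h2 : xx s Q hφ (fun k => star (a k) * a k) - S2 =
      ∑ k ∈ s, ev hφ (Q k * (1 - ∑ j ∈ s, X * Q j)) (PP hφ (star (a k) * a k)) := by
    rw [hS2, Finset.sum_comm, xx, ← Finset.sum_sub_distrib]
    refine Finset.sum_congr rfl fun k hk => ?_
    rw [mul_sub, map_sub, LinearMap.sub_apply, mul_one, Finset.mul_sum, map_sum,
      LinearMap.sum_apply]
    congr 1
    refine Finset.sum_congr rfl fun j hj => ?_
    congr 2
    ring
  have h3 : 0 ≤ ((xx s Q hφ (fun k => star (a k) * a k) - S2 : SS hφ) : B) := by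
    rw [h2, AddSubmonoidClass.coe_finsetSum]
    exact Finset.sum_nonneg fun k hk => ((hQ k hk).mul hQ1).pos _ (hP _)
  rw [h1] at h0
  have h4 : 0 ≤ ((S2 - S1 : SS hφ) : B) := by
    have : ((S2 - S1 : SS hφ) : B) = (2⁻¹ : ℝ) • (((S2 - S1) + (S2 - S1) : SS hφ) : B) := by
      rw [← two_smul ℝ (S2 - S1)]
      push_cast
      rw [smul_smul]; norm_num
    rw [this]
    exact smul_nonneg (by norm_num) h0
  rw [star_xx_mul s Q hφ hQ, ← sub_nonneg, ← hS1]
  have := add_nonneg h3 h4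
  push_cast at this ⊢
  simpa using this

theorem xx_norm_sq {φ : A → B} (hφ : IsCPCOrderZero φ) (hQ : ∀ k ∈ s, Good hφ (Q k))
    (hQ1 : Good hφ (1 - ∑ k ∈ s, X * Q k)) (a : ι → A) :
    ‖xx s Q hφ a‖ * ‖xx s Q hφ a‖ ≤ ‖xx s Q hφ (fun k => star (a k) * a k)‖ := by
  have h := xx_le s Q hφ hQ hQ1 a
  have h' := CStarAlgebra.norm_le_norm_of_nonneg_of_le (by
    push_cast; exact star_mul_self_nonneg _) h
  push_cast at h'
  change ‖star (xx s Q hφ a : B) * (xx s Q hφ a : B)‖ ≤ _ at h'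
  rw [CStarRing.norm_star_mul_self] at h'
  exact h'

theorem xx_norm_le_one {φ : A → B} (hφ : IsCPCOrderZero φ) (hQ : ∀ k ∈ s, Good hφ (Q k))
    (hQ1 : Good hφ (1 - ∑ k ∈ s, X * Q k)) (a : ι → A) (ha : ∀ k, ‖a k‖ ≤ 1) :
    ‖xx s Q hφ a‖ ≤ 1 := by
  choose C hC using fun k => ev_bdd hφ (Q k)
  set T : Set ℝ := {r | ∃ a : ι → A, (∀ k, ‖a k‖ ≤ 1) ∧ r = ‖xx s Q hφ a‖} with hT
  have hbdd : BddAbove T := by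
    refine ⟨∑ k ∈ s, |C k|, ?_⟩
    rintro _ ⟨a, ha, rfl⟩
    refine (norm_sum_le _ _).trans (Finset.sum_le_sum fun k hk => (hC k _).trans ?_)
    have h1 : ‖PP hφ (a k)‖ ≤ 1 := (hφ.contractive (a k)).trans (ha k)
    calc C k * ‖PP hφ (a k)‖ ≤ |C k| * ‖PP hφ (a k)‖ := by gcongr; exact le_abs_self _
      _ ≤ |C k| * 1 := by gcongr
      _ = |C k| := mul_one _
  have hmem : ‖xx s Q hφ a‖ ∈ T := ⟨a, ha, rfl⟩
  have hS0 : 0 ≤ sSup T := (norm_nonneg _).trans (le_csSup hbdd hmem)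
  have h1 : sSup T ≤ √(sSup T) := by
    refine csSup_le ⟨_, hmem⟩ ?_
    rintro _ ⟨b, hb, rfl⟩
    refine Real.le_sqrt_of_sq_le ?_
    rw [sq]
    refine (xx_norm_sq s Q hφ hQ hQ1 b).trans (le_csSup hbdd ⟨_, ?_, rfl⟩)
    intro k
    rw [CStarRing.norm_star_mul_self]
    exact mul_le_one₀ (hb k) (norm_nonneg _) (hb k)
  have h2 : sSup T ≤ 1 := by
    have h3 := Real.sq_sqrt hS0
    by_contra h
    push Not at h
    nlinarith [Real.sqrt_nonneg (sSup T)]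
  exact (le_csSup hbdd hmem).trans h2

theorem xx_norm_le {φ : A → B} (hφ : IsCPCOrderZero φ) (hQ : ∀ k ∈ s, Good hφ (Q k))
    (hQ1 : Good hφ (1 - ∑ k ∈ s, X * Q k)) (a : ι → A) (c : ℝ) (hc : 0 ≤ c)
    (ha : ∀ k, ‖a k‖ ≤ c) : ‖xx s Q hφ a‖ ≤ c := by
  rcases hc.eq_or_lt with rfl | hc
  · have : xx s Q hφ a = 0 := by
      refine Finset.sum_eq_zero fun k _ => ?_
      have : a k = 0 := by simpa using ha k
      simp [this]
    simp [this]
  · have h := xx_norm_le_one s Q hφ hQ hQ1 (fun k => ((c⁻¹ : ℝ) : ℂ) • a k) (fun k => by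
      rw [norm_smul, Complex.norm_real, Real.norm_of_nonneg (by positivity)]
      rw [inv_mul_le_iff₀ hc]; simpa using ha k)
    have h2 : xx s Q hφ (fun k => ((c⁻¹ : ℝ) : ℂ) • a k) = ((c⁻¹ : ℝ) : ℂ) • xx s Q hφ a := by
      simp only [xx, map_smul, Finset.smul_sum]
    rw [h2, norm_smul, Complex.norm_real, Real.norm_of_nonneg (by positivity),
      inv_mul_le_iff₀ hc] at h
    simpa using h
end est
end Part4

section Part5
open Polynomial

theorem bern_deriv (n k : ℕ) (hk : k ≤ n) :
    X * (1 - X) * derivative (bernsteinPolynomial ℂ n k) =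
      ((k : ℂ[X]) - (n : ℂ[X]) * X) * bernsteinPolynomial ℂ n k := by
  obtain ⟨l, rfl⟩ := Nat.exists_eq_add_of_le hk
  simp only [bernsteinPolynomial, Nat.add_sub_cancel_left]
  have h1 : X * derivative (X ^ k : ℂ[X]) = (k : ℂ[X]) * X ^ k := by
    rcases k with _ | k
    · simp
    · rw [derivative_X_pow]; simp; ring
  have h2 : (1 - X) * derivative ((1 - X) ^ l : ℂ[X]) = - (l : ℂ[X]) * (1 - X) ^ l := by
    rcases l with _ | l
    · simp
    · rw [derivative_pow]; simp; ring
  rw [derivative_mul, derivative_mul, derivative_natCast]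
  push_cast
  linear_combination ((k + l).choose k : ℂ[X]) * (1 - X) ^ l * (1 - X) * h1 +
    ((k + l).choose k : ℂ[X]) * X ^ k * X * h2

/-- Bernstein moments -/
noncomputable def bm (n m : ℕ) : ℂ[X] :=
  ∑ k ∈ Finset.range (n + 1), ((k : ℂ) / n) ^ m • bernsteinPolynomial ℂ n k

theorem bm_succ (n m : ℕ) (hn : n ≠ 0) :
    bm n (m + 1) = X * bm n m + (1 / (n : ℂ)) • (X * (1 - X) * derivative (bm n m)) := by
  have hn' : (n : ℂ) ≠ 0 := by exact_mod_cast hn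
  simp only [bm, derivative_sum, Finset.mul_sum, Finset.smul_sum, ← Finset.sum_add_distrib]
  refine Finset.sum_congr rfl fun k hk => ?_
  rw [derivative_smul, mul_smul_comm, mul_smul_comm,
    bern_deriv n k (by simp at hk; omega)]
  simp only [smul_eq_C_mul, pow_succ, C_mul]
  have e1 : C ((k : ℂ) / n) = C (1 / (n : ℂ)) * (k : ℂ[X]) := by
    rw [← C_eq_natCast, ← C_mul]; congr 1; ring
  have e2 : C (1 / (n : ℂ)) * (n : ℂ[X]) = 1 := by
    rw [← C_eq_natCast, ← C_mul]; simp [hn']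
  rw [e1]
  linear_combination (- (C (1 / (n : ℂ)) * (k : ℂ[X])) ^ m * 0 + 
    C (((k : ℂ) / n) ^ m) * X * bernsteinPolynomial ℂ n k) * e2

theorem bm_tendsto {E : Type*} [NormedAddCommGroup E] [NormedSpace ℂ E] (m : ℕ)
    (L : ℂ[X] →ₗ[ℂ] E) : Tendsto (fun n => L (bm n m)) atTop (𝓝 (L (X ^ m))) := by
  induction m generalizing L with
  | zero =>
    have : ∀ n, bm n 0 = 1 := fun n => by
      simp only [bm, pow_zero, one_smul]; exact bernsteinPolynomial.sum ℂ n
    simp [this]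
  | succ m ih =>
    have h1 := ih (L ∘ₗ LinearMap.mulLeft ℂ X)
    have h2 := ih (L ∘ₗ LinearMap.mulLeft ℂ (X * (1 - X)) ∘ₗ derivative)
    have h3 : Tendsto (fun n : ℕ => (1 / (n : ℂ))) atTop (𝓝 0) :=
      tendsto_one_div_atTop_nhds_zero_nat
    have h4 := h1.add (h3.smul h2)
    rw [zero_smul, add_zero] at h4
    simp only [LinearMap.comp_apply, LinearMap.mulLeft_apply, ← pow_succ'] at h4
    refine h4.congr' ?_
    filter_upwards [eventually_ne_atTop 0] with n hn
    rw [bm_succ n m hn, map_add, map_smul]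

/-- the Bernstein polynomials divided by `X` -/
noncomputable def bq (n k : ℕ) : ℂ[X] :=
  (n.choose (k + 1) : ℂ[X]) * X ^ k * (1 - X) ^ (n - (k + 1))

theorem X_mul_bq (n k : ℕ) : X * bq n k = bernsteinPolynomial ℂ n (k + 1) := by
  rw [bq, bernsteinPolynomial]; ring

theorem one_sub_sum_bq (n : ℕ) : 1 - ∑ k ∈ Finset.range n, X * bq n k = (1 - X) ^ n := by
  simp only [X_mul_bq]
  have h := bernsteinPolynomial.sum ℂ n
  rw [Finset.sum_range_succ'] at h
  have h2 : bernsteinPolynomial ℂ n 0 = (1 - X) ^ n := by simp [bernsteinPolynomial]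
  rw [← h2]
  linear_combination -h

/-- division by `X`, as a linear map -/
noncomputable def divXL : ℂ[X] →ₗ[ℂ] ℂ[X] where
  toFun := divX
  map_add' p q := divX_add
  map_smul' c p := by ext n; simp

theorem bm_eq (n m : ℕ) : bm n (m + 1) =
    ∑ k ∈ Finset.range n, (((k + 1 : ℕ) : ℂ) / n) ^ (m + 1) • (X * bq n k) := by
  rw [bm, Finset.sum_range_succ']
  simp [X_mul_bq]

variable {A B : Type*} [NonUnitalCStarAlgebra A] [NonUnitalCStarAlgebra B]
    [PartialOrder A] [StarOrderedRing A] [PartialOrder B] [StarOrderedRing B]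

theorem Good_bq {φ : A → B} (hφ : IsCPCOrderZero φ) (n k : ℕ) : Good hφ (bq n k) :=
  ((Good.natCast hφ _).mul ((Good.X hφ).pow _)).mul ((Good.one_sub_X hφ).pow _)

/-- the approximants -/
noncomputable def yy {φ : A → B} (hφ : IsCPCOrderZero φ) (n : ℕ) (a : ℕ → A) : SS hφ :=
  xx (Finset.range n) (bq n) hφ a

theorem yy_norm {φ : A → B} (hφ : IsCPCOrderZero φ) (n : ℕ) (a : ℕ → A) (c : ℝ) (hc : 0 ≤ c)
    (ha : ∀ k, ‖a k‖ ≤ c) : ‖yy hφ n a‖ ≤ c := by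
  refine xx_norm_le _ _ hφ (fun k _ => Good_bq hφ n k) ?_ a c hc ha
  rw [one_sub_sum_bq]
  exact (Good.one_sub_X hφ).pow n

theorem yy_tendsto {φ : A → B} (hφ : IsCPCOrderZero φ) (m : ℕ) (a : A) :
    Tendsto (fun n => yy hφ n (fun k => (((k + 1 : ℕ) : ℂ) / n) ^ (m + 1) • a)) atTop
      (𝓝 ((TT hφ ^ m) (PP hφ a))) := by
  have h := bm_tendsto (m + 1) ((LinearMap.applyₗ (PP hφ a)) ∘ₗ (ev hφ).toLinearMap ∘ₗ divXL)
  have hd : ∀ p, divXL (X * p) = p := fun p => by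
    change divX (X * p) = p
    ext n; simp
  have e : (LinearMap.applyₗ (PP hφ a) ∘ₗ (ev hφ).toLinearMap ∘ₗ divXL) (X ^ (m + 1)) =
      (TT hφ ^ m) (PP hφ a) := by
    rw [pow_succ']
    simp [hd, LinearMap.comp_apply, ev]
  rw [e] at h
  refine h.congr fun n => ?_
  rw [bm_eq, map_sum]
  simp only [map_smul, LinearMap.comp_apply, hd, yy, xx, LinearMap.applyₗ_apply_apply,
      AlgHom.toLinearMap_apply]
end Part5

section Part6
open Polynomial
variable {A B : Type*} [NonUnitalCStarAlgebra A] [NonUnitalCStarAlgebra B]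

/-- the function `t ↦ t ^ (m + 1) • a` -/
noncomputable def mono (m : ℕ) (a : A) : cone A :=
  ⟨⟨fun t => ((t : ℝ) ^ (m + 1)) • a, by fun_prop⟩, by
    show (((0 : unitInterval) : ℝ) ^ (m + 1)) • a = 0
    simp⟩

theorem mono_apply (m : ℕ) (a : A) (t : unitInterval) :
    (mono m a).1 t = ((t : ℝ) ^ (m + 1)) • a := rfl

theorem cone_ext {f g : cone A} (h : ∀ t, f.1 t = g.1 t) : f = g :=
  Subtype.ext (ContinuousMap.ext h)

/-- the function `t ↦ t * p t • a` -/
noncomputable def pe (p : ℝ[X]) (a : A) : cone A :=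
  ⟨⟨fun t => ((t : ℝ) * p.eval (t : ℝ)) • a, by fun_prop⟩, by
    show (((0 : unitInterval) : ℝ) * p.eval ((0 : unitInterval) : ℝ)) • a = 0
    simp⟩

theorem pe_apply (p : ℝ[X]) (a : A) (t : unitInterval) :
    (pe p a).1 t = ((t : ℝ) * p.eval (t : ℝ)) • a := rfl

theorem cone_zero {f : cone A} : f.1 0 = 0 := f.2

theorem cone_sum_apply {ι : Type*} (s : Finset ι) (F : ι → cone A) (t : unitInterval) :
    (∑ k ∈ s, F k).1 t = ∑ k ∈ s, (F k).1 t := by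
  have : (∑ k ∈ s, F k).1 = ∑ k ∈ s, (F k).1 := AddSubmonoidClass.coe_finsetSum F s
  rw [this, ContinuousMap.sum_apply]

theorem cone_dense {P : cone A → Prop} (hcl : IsClosed {f | P f}) (h0 : P 0)
    (hadd : ∀ f g, P f → P g → P (f + g)) (hm : ∀ m a, P (mono m a)) (f : cone A) : P f := by
  have hpe : ∀ (p : ℝ[X]) (a : A), P (pe p a) := by
    intro p a
    induction p using Polynomial.induction_on' with
    | add p q hp hq =>
      convert hadd _ _ hp hq using 1
      refine cone_ext fun t => ?_
      change _ = (pe p a).1 t + (pe q a).1 t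
      simp only [pe_apply, eval_add, ← add_smul, mul_add]
    | monomial n c =>
      convert hm n (c • a) using 1
      refine cone_ext fun t => ?_
      simp only [pe_apply, mono_apply, eval_monomial, smul_smul]
      congr 1; ring
  have hsum : ∀ (s : Finset ℕ) (p : ℕ → ℝ[X]) (a : ℕ → A), P (∑ k ∈ s, pe (p k) (a k)) := by
    intro s p a
    induction s using Finset.cons_induction with
    | empty => simpa using h0
    | cons k s hk ih => rw [Finset.sum_cons]; exact hadd _ _ (hpe _ _) ih
  set z : ℕ → ℕ → unitInterval := fun n k => Set.projIcc 0 1 zero_le_one ((k : ℝ) / n) with hz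
  set u : ℕ → cone A := fun n => ∑ k ∈ Finset.range n,
    pe ((n.choose (k + 1) : ℝ[X]) * X ^ k * (1 - X) ^ (n - (k + 1))) (f.1 (z n (k + 1))) with hu
  have hlim : Tendsto u atTop (𝓝 f) := by
    rw [tendsto_subtype_rng]
    refine (bernsteinApproximation_uniform f.1).congr fun n => ?_
    ext t
    rw [bernsteinApproximation.apply]
    change _ = (u n).1 t
    rw [hu, cone_sum_apply, Fin.sum_univ_succ, bernstein.z_zero, cone_zero, smul_zero, zero_add,
      Finset.sum_range]
    refine Finset.sum_congr rfl fun k _ => ?_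
    rw [pe_apply, bernstein_apply]
    congr 1
    · simp; ring
    · congr 1
      have hmem : (((k : ℕ) + 1 : ℕ) : ℝ) / n ∈ Set.Icc (0 : ℝ) 1 := by
        have hk := k.2
        constructor
        · positivity
        · rw [div_le_one (by exact_mod_cast (by omega : 0 < n))]
          exact_mod_cast hk
      rw [hz]
      simp only
      rw [Set.projIcc_of_mem zero_le_one hmem]
      rfl
  exact hcl.mem_of_tendsto hlim (Eventually.of_forall fun n => hsum _ _ _)

theorem isClosed_cone : IsClosed (cone A : Set C(unitInterval, A)) :=
  isClosed_eq (f := fun f : C(unitInterval, A) => f 0) (by fun_prop) continuous_const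

instance : IsClosed (cone A : Set C(unitInterval, A)) := isClosed_cone

theorem hom_continuous (Ψ : cone A →⋆ₙₐ[ℂ] B) : Continuous Ψ :=
  AddMonoidHomClass.continuous_of_bound Ψ 1 fun f => by
    rw [one_mul]; exact NonUnitalStarAlgHom.norm_apply_le Ψ f

theorem mono_mul (m n : ℕ) (a b : A) : mono m a * mono n b = mono (m + n + 1) (a * b) := by
  refine cone_ext fun t => ?_
  change (mono m a).1 t * (mono n b).1 t = _
  simp only [mono_apply, smul_mul_smul_comm]
  congr 1; ring

theorem mono_add (m : ℕ) (a b : A) : mono m (a + b) = mono m a + mono m b := by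
  refine cone_ext fun t => ?_
  change _ = (mono m a).1 t + (mono m b).1 t
  simp [mono_apply]

theorem mono_smul (m : ℕ) (c : ℂ) (a : A) : mono m (c • a) = c • mono m a := by
  refine cone_ext fun t => ?_
  change _ = c • (mono m a).1 t
  simp only [mono_apply]
  rw [smul_comm]

theorem mono_star (m : ℕ) (a : A) : star (mono m a) = mono m (star a) := by
  refine cone_ext fun t => ?_
  change star ((mono m a).1 t) = _
  simp only [mono_apply]
  simp

theorem mono_zero_eq (a : A) : mono 0 a = coneElem a := by
  refine cone_ext fun t => ?_
  rw [mono_apply, zero_add, pow_one]; rfl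

theorem hom_unique [PartialOrder A] [StarOrderedRing A] (Ψ Ψ' : cone A →⋆ₙₐ[ℂ] B)
    (h : ∀ a, Ψ (coneElem a) = Ψ' (coneElem a)) : Ψ = Ψ' := by
  have hm : ∀ m a, Ψ (mono m a) = Ψ' (mono m a) := by
    intro m
    induction m with
    | zero => intro a; rw [mono_zero_eq]; exact h a
    | succ m ih =>
      intro a
      refine prod_induction (P := fun a => Ψ (mono (m + 1) a) = Ψ' (mono (m + 1) a)) ?_ ?_ ?_ a
      · intro a b ha hb
        rw [mono_add, map_add, map_add, ha, hb]
      · intro c a ha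
        rw [mono_smul, map_smul, map_smul, ha]
      · intro b c
        have := mono_mul m 0 (star b) c
        rw [add_zero] at this
        rw [← this, map_mul, map_mul, ih, mono_zero_eq, h]
  ext f
  refine cone_dense (P := fun f => Ψ f = Ψ' f)
    (isClosed_eq (hom_continuous Ψ) (hom_continuous Ψ')) (by simp) ?_ hm f
  intro f g hf hg
  rw [map_add, map_add, hf, hg]

variable [PartialOrder A] [StarOrderedRing A] [PartialOrder B] [StarOrderedRing B]

/-- the approximants -/
noncomputable def GG {φ : A → B} (hφ : IsCPCOrderZero φ) (n : ℕ) (f : cone A) : SS hφ :=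
  yy hφ n (fun k => f.1 (Set.projIcc 0 1 zero_le_one (((k + 1 : ℕ) : ℝ) / n)))

theorem GG_add {φ : A → B} (hφ : IsCPCOrderZero φ) (n : ℕ) (f g : cone A) :
    GG hφ n (f + g) = GG hφ n f + GG hφ n g := by
  simp only [GG, yy, xx, ← Finset.sum_add_distrib, ← map_add]
  rfl

theorem GG_smul {φ : A → B} (hφ : IsCPCOrderZero φ) (n : ℕ) (c : ℂ) (f : cone A) :
    GG hφ n (c • f) = c • GG hφ n f := by
  simp only [GG, yy, xx, Finset.smul_sum, ← map_smul]
  rfl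

theorem GG_norm {φ : A → B} (hφ : IsCPCOrderZero φ) (n : ℕ) (f : cone A) :
    ‖GG hφ n f‖ ≤ ‖f‖ :=
  yy_norm hφ n _ _ (norm_nonneg _) fun k => ContinuousMap.norm_coe_le_norm f.1 _

theorem GG_mono {φ : A → B} (hφ : IsCPCOrderZero φ) (m : ℕ) (a : A) :
    Tendsto (fun n => GG hφ n (mono m a)) atTop (𝓝 ((TT hφ ^ m) (PP hφ a))) := by
  refine (yy_tendsto hφ m a).congr fun n => ?_
  simp only [GG, yy, xx]
  refine Finset.sum_congr rfl fun k hk => ?_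
  congr 2
  have hk := Finset.mem_range.mp hk
  have hmem : (((k : ℕ) + 1 : ℕ) : ℝ) / n ∈ Set.Icc (0 : ℝ) 1 := by
    constructor
    · positivity
    · rw [div_le_one (by exact_mod_cast (by omega : 0 < n))]
      exact_mod_cast hk
  rw [Set.projIcc_of_mem zero_le_one hmem, mono_apply, ← Complex.coe_smul]
  push_cast
  rfl

theorem GG_tendsto {φ : A → B} (hφ : IsCPCOrderZero φ) (f : cone A) :
    ∃ y, Tendsto (fun n => GG hφ n f) atTop (𝓝 y) := by
  have : CompleteSpace (SS hφ) := (isClosed_SS hφ).completeSpace_coe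
  have hcl := closed_conv (E := cone A) (F := SS hφ) atTop (GG hφ)
    (Eventually.of_forall fun n f g => by
      rw [dist_eq_norm, dist_eq_norm]
      have : GG hφ n f - GG hφ n g = GG hφ n (f - g) := by
        rw [sub_eq_iff_eq_add, ← GG_add, sub_add_cancel]
      rw [this]
      exact GG_norm hφ n _) Set.univ isClosed_univ
  obtain ⟨y, -, hy⟩ := cone_dense (P := fun f => ∃ y ∈ Set.univ,
    Tendsto (fun n => GG hφ n f) atTop (𝓝 y)) hcl
    ⟨0, trivial, by
      have : ∀ n, GG hφ n 0 = 0 := fun n => by simpa using GG_smul hφ n 0 0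
      simp [this]⟩
    (fun f g ⟨y, _, hy⟩ ⟨z, _, hz⟩ => ⟨y + z, trivial, by simpa [GG_add] using hy.add hz⟩)
    (fun m a => ⟨_, trivial, GG_mono hφ m a⟩) f
  exact ⟨y, hy⟩

/-- the limit map -/
noncomputable def Lim {φ : A → B} (hφ : IsCPCOrderZero φ) : cone A →ₗ[ℂ] SS hφ where
  toFun f := (GG_tendsto hφ f).choose
  map_add' f g := by
    refine tendsto_nhds_unique (GG_tendsto hφ (f + g)).choose_spec ?_
    simpa [GG_add] using (GG_tendsto hφ f).choose_spec.add (GG_tendsto hφ g).choose_spec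
  map_smul' c f := by
    refine tendsto_nhds_unique (GG_tendsto hφ (c • f)).choose_spec ?_
    simpa [GG_smul] using (GG_tendsto hφ f).choose_spec.const_smul c

theorem Lim_spec {φ : A → B} (hφ : IsCPCOrderZero φ) (f : cone A) :
    Tendsto (fun n => GG hφ n f) atTop (𝓝 (Lim hφ f)) := (GG_tendsto hφ f).choose_spec

theorem Lim_mono {φ : A → B} (hφ : IsCPCOrderZero φ) (m : ℕ) (a : A) :
    Lim hφ (mono m a) = (TT hφ ^ m) (PP hφ a) :=
  tendsto_nhds_unique (Lim_spec hφ _) (GG_mono hφ m a)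

theorem Lim_continuous {φ : A → B} (hφ : IsCPCOrderZero φ) : Continuous (Lim hφ) :=
  AddMonoidHomClass.continuous_of_bound (Lim hφ) 1 fun f => by
    rw [one_mul]
    exact le_of_tendsto (Lim_spec hφ f).norm (Eventually.of_forall fun n => GG_norm hφ n f)

theorem Lim_mul_mono {φ : A → B} (hφ : IsCPCOrderZero φ) (m n : ℕ) (a b : A) :
    Lim hφ (mono m a * mono n b) = Lim hφ (mono m a) * Lim hφ (mono n b) := by
  have hp : ∀ m : ℕ, TT hφ ^ m = ev hφ (X ^ m) := fun m => by simp [ev]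
  rw [mono_mul, Lim_mono, Lim_mono, Lim_mono, hp, hp, hp, ← ev_mul_left, ← ev_mul_right, PP_mul,
    ← ev_X, ← ev_mul, ← ev_mul]
  congr 2
  ring

theorem Lim_mul {φ : A → B} (hφ : IsCPCOrderZero φ) (f g : cone A) :
    Lim hφ (f * g) = Lim hφ f * Lim hφ g := by
  have hc := Lim_continuous hφ
  refine cone_dense (P := fun f => Lim hφ (f * g) = Lim hφ f * Lim hφ g)
    (isClosed_eq (hc.comp (continuous_id.mul continuous_const)) (hc.mul continuous_const))
    (by simp) (fun f f' h h' => by simp [add_mul, h, h']) (fun m a => ?_) f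
  refine cone_dense (P := fun g => Lim hφ (mono m a * g) = Lim hφ (mono m a) * Lim hφ g)
    (isClosed_eq (hc.comp (continuous_const.mul continuous_id)) (continuous_const.mul hc))
    (by simp) (fun f f' h h' => by simp [mul_add, h, h']) (fun n b => ?_) g
  exact Lim_mul_mono hφ m n a b

theorem Lim_star {φ : A → B} (hφ : IsCPCOrderZero φ) (f : cone A) :
    Lim hφ (star f) = star (Lim hφ f) := by
  have hc := Lim_continuous hφ
  have hs : Continuous (fun x : SS hφ => star x) :=
    Continuous.subtype_mk (continuous_star.comp continuous_subtype_val) _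
  refine cone_dense (P := fun f => Lim hφ (star f) = star (Lim hφ f))
    (isClosed_eq (hc.comp continuous_star) (hs.comp hc))
    (by simp) (fun f f' h h' => by simp [h, h']) (fun m a => ?_) f
  have hp : ∀ m : ℕ, TT hφ ^ m = ev hφ (X ^ m) := fun m => by simp [ev]
  rw [mono_star, Lim_mono, Lim_mono, hp, ((Good.X hφ).pow m).star, PP_star]

/-- the homomorphism -/
noncomputable def Phi {φ : A → B} (hφ : IsCPCOrderZero φ) : cone A →⋆ₙₐ[ℂ] B where
  toFun f := (Lim hφ f : B)
  map_smul' c f := by simp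
  map_zero' := by simp
  map_add' f g := by simp
  map_mul' f g := by simp [Lim_mul]
  map_star' f := by simp [Lim_star]

theorem Phi_coneElem {φ : A → B} (hφ : IsCPCOrderZero φ) (a : A) : Phi hφ (coneElem a) = φ a := by
  change (Lim hφ (coneElem a) : B) = φ a
  rw [← mono_zero_eq, Lim_mono]
  simp

/-- the function `t ↦ √t • a` -/
noncomputable def sq (a : A) : cone A :=
  ⟨⟨fun t => (√(t : ℝ)) • a, by fun_prop⟩, by
    show (√((0 : unitInterval) : ℝ)) • a = 0
    simp⟩

theorem sq_mul (a b : A) : star (sq a) * sq b = coneElem (star a * b) := by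
  refine cone_ext fun t => ?_
  change star ((√(t : ℝ)) • a) * ((√(t : ℝ)) • b) = (t : ℝ) • (star a * b)
  rw [star_smul, smul_mul_smul_comm, star_trivial, Real.mul_self_sqrt t.2.1]

theorem converse (Ψ : cone A →⋆ₙₐ[ℂ] B) : IsCPCOrderZero (fun a : A => Ψ (coneElem a)) where
  map_add a b := by simp only [← mono_zero_eq, mono_add, map_add]
  map_smul c a := by simp only [← mono_zero_eq, mono_smul, map_smul]
  contractive a := by
    refine (NonUnitalStarAlgHom.norm_apply_le Ψ _).trans ?_
    change ‖(coneElem a).1‖ ≤ ‖a‖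
    rw [ContinuousMap.norm_le _ (norm_nonneg _)]
    intro t
    change ‖(t : ℝ) • a‖ ≤ ‖a‖
    rw [norm_smul, Real.norm_of_nonneg t.2.1]
    exact mul_le_of_le_one_left (norm_nonneg _) t.2.2
  completelyPositive n N := by
    refine ⟨Matrix.of fun i j => Ψ (sq (N i j)), ?_⟩
    ext i j
    simp only [Matrix.map_apply, Matrix.mul_apply, Matrix.conjTranspose_apply, Matrix.of_apply]
    have : ∀ s : Finset (Fin n), coneElem (∑ k ∈ s, star (N k i) * N k j) =
        ∑ k ∈ s, coneElem (star (N k i) * N k j) := fun s => by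
      refine cone_ext fun t => ?_
      rw [cone_sum_apply]
      exact Finset.smul_sum
    rw [this, map_sum]
    refine Finset.sum_congr rfl fun k _ => ?_
    rw [← sq_mul, map_mul, StarHomClass.map_star]
  orderZero a b ha hb hab := by
    rw [← map_mul, ← mono_zero_eq, ← mono_zero_eq, mono_mul, hab]
    have : mono (0 + 0 + 1) (0 : A) = 0 := by simpa using mono_smul 1 0 (0 : A)
    rw [this, map_zero]

end Part6
end OZ

/-- Structure theorem for c.p.c. order zero maps (Winter–Zacharias): for every c.p.c.
order zero map `φ : A → B` there is a unique *-homomorphism `Φ : C₀(0,1] ⊗ A → B` with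
`Φ(id ⊗ a) = φ a` for all `a`; conversely, every *-homomorphism `Ψ : C₀(0,1] ⊗ A → B`
yields a c.p.c. order zero map `a ↦ Ψ(id ⊗ a)`. -/
theorem orderZero_structure (A B : Type*) [NonUnitalCStarAlgebra A] [NonUnitalCStarAlgebra B]
    [PartialOrder A] [StarOrderedRing A] [PartialOrder B] [StarOrderedRing B]
    (φ : A → B) (hφ : IsCPCOrderZero φ) :
    (∃! Φ : cone A →⋆ₙₐ[ℂ] B, ∀ a : A, Φ (coneElem a) = φ a) ∧
    (∀ Ψ : cone A →⋆ₙₐ[ℂ] B, IsCPCOrderZero (fun a : A => Ψ (coneElem a))) := by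
  refine ⟨⟨OZ.Phi hφ, OZ.Phi_coneElem hφ, fun Ψ hΨ => ?_⟩, OZ.converse⟩
  exact OZ.hom_unique Ψ _ fun a => by rw [hΨ, OZ.Phi_coneElem hφ]
end

section
/- Let A be a separable C*-algebra, J ⊆ A a closed two-sided ideal, and (e_n) an approximate unit for J with e_{n+1}e_n = e_n. Then there exists an approximate unit (h_i) for J contained in the convex hull of {e_n : n ∈ ℕ}, which is quasicentral for A (‖h_i a − a h_i‖ → 0 for all a ∈ A) and satisfies h_{i+1} h_i = h_i for all i. -/
open Filter in
lemma qau_conj {A : Type*} [CStarAlgebra A] (J : TwoSidedIdeal A)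
    (e : ℕ → A) (hsa : ∀ n, star (e n) = e n)
    (heapprox : ∀ x ∈ J, Tendsto (fun n => ‖e n * x - x‖) atTop (nhds 0))
    (x : A) (hx : x ∈ J) (a : A) :
    Tendsto (fun n => ‖star x * (e n * a - a * e n)‖) atTop (nhds 0) := by
  have key : ∀ y ∈ J, Tendsto (fun n => ‖star y * e n - star y‖) atTop (nhds 0) := by
    intro y hy
    refine (heapprox y hy).congr fun n => ?_
    rw [← norm_star]
    simp [hsa]
  have h1 := key x hx
  have h2 := key (star a * x) (J.mul_mem_left _ _ hx)
  have h3 : Tendsto (fun n => ‖star x * e n - star x‖ * ‖a‖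
      + ‖star (star a * x) * e n - star (star a * x)‖) atTop (nhds 0) := by
    simpa using (h1.mul_const ‖a‖).add h2
  refine squeeze_zero (fun _ => norm_nonneg _) (fun n => ?_) h3
  have : star x * (e n * a - a * e n) = (star x * e n - star x) * a
      - (star (star a * x) * e n - star (star a * x)) := by
    simp only [star_mul, star_star]; noncomm_ring
  rw [this]
  exact (norm_sub_le _ _).trans (by gcongr; exact norm_mul_le _ _)

lemma qau_sq {A : Type*} [CStarAlgebra A] (X c : A) :
    ‖X + c‖ ^ 2 ≤ ‖X‖ ^ 2 + ‖c‖ ^ 2 + 2 * ‖star X * c‖ := by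
  have h : ‖X + c‖ ^ 2 = ‖star (X + c) * (X + c)‖ := by
    rw [CStarRing.norm_star_mul_self, sq]
  have h1 : ‖X‖ ^ 2 = ‖star X * X‖ := by rw [CStarRing.norm_star_mul_self, sq]
  have h2 : ‖c‖ ^ 2 = ‖star c * c‖ := by rw [CStarRing.norm_star_mul_self, sq]
  have h3 : ‖star c * X‖ = ‖star X * c‖ := by
    rw [← norm_star]; simp
  have h4 : star (X + c) * (X + c) = star X * X + star c * c + (star X * c + star c * X) := by
    simp only [star_add]; noncomm_ring
  rw [h, h1, h2, h4]
  have h5 := norm_add_le (star X * X + star c * c) (star X * c + star c * X)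
  have h6 := norm_add_le (star X * X) (star c * c)
  have h7 := norm_add_le (star X * c) (star c * X)
  linarith

lemma qau_smul_mem {A : Type*} [CStarAlgebra A] (J : TwoSidedIdeal A) (r : ℝ) (x : A)
    (hx : x ∈ J) : r • x ∈ J := by
  have := J.mul_mem_left (r • (1 : A)) x hx
  simpa using this

open Filter in
lemma qau_step {A : Type*} [CStarAlgebra A] [PartialOrder A] [StarOrderedRing A]
    (J : TwoSidedIdeal A)
    (e : ℕ → A) (heJ : ∀ n, e n ∈ J) (hepos : ∀ n, 0 ≤ e n) (henorm : ∀ n, ‖e n‖ ≤ 1)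
    (hemono : Monotone e)
    (heapprox : ∀ x ∈ J, Tendsto (fun n => ‖e n * x - x‖) atTop (nhds 0))
    (hee : ∀ m n, n < m → e m * e n = e n) (F : Finset A) (N K : ℕ) :
    ∃ h ∈ convexHull ℝ (e '' Set.Ici N), h ∈ J ∧
      (∃ M, N < M ∧ ∀ m, M ≤ m → e m * h = h ∧ h ≤ e m) ∧
      ∀ a ∈ F, (K + 1 : ℝ) * ‖h * a - a * h‖ ^ 2 ≤ 4 * ‖a‖ ^ 2 + 1 := by
  have hc : ∀ n a, ‖e n * a - a * e n‖ ^ 2 ≤ 4 * ‖a‖ ^ 2 := by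
    intro n a
    have h1 : ‖e n * a - a * e n‖ ≤ 2 * ‖a‖ := by
      have h2 := norm_sub_le (e n * a) (a * e n)
      have h3 := norm_mul_le (e n) a
      have h4 := norm_mul_le a (e n)
      have h5 := henorm n
      nlinarith [norm_nonneg a]
    nlinarith [norm_nonneg (e n * a - a * e n)]
  induction K with
  | zero =>
    refine ⟨e N, subset_convexHull _ _ ⟨N, by simp, rfl⟩, heJ N, ⟨N + 1, by omega, fun m hm =>
      ⟨hee _ _ (by omega), hemono (by omega)⟩⟩, fun a _ => ?_⟩
    have := hc N a
    push_cast
    linarith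
  | succ K ih =>
    obtain ⟨h, hconv, hJ, ⟨M, hNM, hM⟩, hF⟩ := ih
    have hev : ∀ᶠ n in atTop, ∀ a ∈ F, ‖star (h * a - a * h) * (e n * a - a * e n)‖
        < 1 / (2 * ((K : ℝ) + 1)) := by
      rw [Filter.eventually_all_finset]
      intro a _
      refine (qau_conj J e (fun n => (IsSelfAdjoint.of_nonneg (hepos n)).star_eq) heapprox
        (h * a - a * h) (J.sub_mem (J.mul_mem_right _ _ hJ) (J.mul_mem_left _ _ hJ)) a).eventually
        (gt_mem_nhds (by positivity))
    obtain ⟨n, hn, hNn⟩ := (hev.and (eventually_ge_atTop N)).exists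
    have hK : (0 : ℝ) < K + 2 := by positivity
    set s : ℝ := (K + 1) / (K + 2) with hs
    set t : ℝ := 1 / (K + 2) with ht
    have hs0 : 0 ≤ s := by positivity
    have ht0 : 0 ≤ t := by positivity
    have hst : s + t = 1 := by rw [hs, ht]; field_simp; ring
    refine ⟨s • h + t • e n, (convex_convexHull ℝ _) hconv
      (subset_convexHull _ _ ⟨n, hNn, rfl⟩) hs0 ht0 hst,
      J.add_mem (qau_smul_mem J _ _ hJ) (qau_smul_mem J _ _ (heJ n)),
      ⟨max M (n + 1), lt_max_of_lt_left hNM, fun m hm => ⟨?_, ?_⟩⟩, fun a ha => ?_⟩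
    · rw [mul_add, mul_smul_comm, mul_smul_comm, (hM m (le_trans (le_max_left _ _) hm)).1,
        hee m n (lt_of_lt_of_le (Nat.lt_succ_self n) (le_trans (le_max_right _ _) hm))]
    · have h1 := (hM m (le_trans (le_max_left _ _) hm)).2
      have h2 : e n ≤ e m :=
        hemono (le_trans (Nat.le_succ n) (le_trans (le_max_right _ _) hm))
      exact (convex_Iic (𝕜 := ℝ) (e m)) h1 h2 hs0 ht0 hst
    · have h1 := hF a ha
      have h2 := hn a ha
      have h3 := hc n a
      set X := h * a - a * h
      set c := e n * a - a * e n
      have h4 : (s • h + t • e n) * a - a * (s • h + t • e n)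
          = t • (((K : ℝ) + 1) • X + c) := by
        have : s = t * (K + 1) := by rw [hs, ht]; ring
        rw [this]
        simp only [X, c, add_mul, mul_add, smul_mul_assoc, mul_smul_comm, smul_sub, smul_add,
          smul_smul]
        abel
      have h5 := qau_sq (((K : ℝ) + 1) • X) c
      have hK1 : (0 : ℝ) ≤ K + 1 := by positivity
      have h6 : ‖((K : ℝ) + 1) • X‖ = (K + 1) * ‖X‖ := by
        rw [norm_smul, Real.norm_of_nonneg hK1]
      have h7 : ‖star (((K : ℝ) + 1) • X) * c‖ = (K + 1) * ‖star X * c‖ := by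
        rw [star_smul, smul_mul_assoc, norm_smul]
        simp [abs_of_nonneg hK1]
      rw [h6, h7] at h5
      rw [h4, norm_smul, Real.norm_of_nonneg ht0, mul_pow, ht]
      push_cast
      have h8 : ‖((K : ℝ) + 1) • X + c‖ ^ 2 ≤ (K + 2) * (4 * ‖a‖ ^ 2 + 1) := by
        rw [lt_div_iff₀ (by positivity)] at h2
        nlinarith [mul_le_mul_of_nonneg_left h1 hK1]
      calc ((K : ℝ) + 1 + 1) * ((1 / (K + 2)) ^ 2 * ‖((K : ℝ) + 1) • X + c‖ ^ 2)
          = ‖((K : ℝ) + 1) • X + c‖ ^ 2 / (K + 2) := by field_simp; ring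
        _ ≤ _ := by rw [div_le_iff₀ hK]; linarith

open Filter in
lemma qau_step2 {A : Type*} [CStarAlgebra A] [PartialOrder A] [StarOrderedRing A]
    (J : TwoSidedIdeal A)
    (e : ℕ → A) (heJ : ∀ n, e n ∈ J) (hepos : ∀ n, 0 ≤ e n) (henorm : ∀ n, ‖e n‖ ≤ 1)
    (hemono : Monotone e)
    (heapprox : ∀ x ∈ J, Tendsto (fun n => ‖e n * x - x‖) atTop (nhds 0))
    (hee : ∀ m n, n < m → e m * e n = e n) (F : Finset A) (N : ℕ) (ε : ℝ) (hε : 0 < ε) :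
    ∃ (h : A) (M : ℕ), h ∈ convexHull ℝ (e '' Set.Ici N) ∧ h ∈ J ∧
      N < M ∧ (∀ m, M ≤ m → e m * h = h ∧ h ≤ e m) ∧
      ∀ a ∈ F, ‖h * a - a * h‖ ≤ ε := by
  obtain ⟨K, hK⟩ := exists_nat_ge ((∑ a ∈ F, (4 * ‖a‖ ^ 2 + 1)) / ε ^ 2)
  obtain ⟨h, h1, h2, ⟨M, h3, h4⟩, h5⟩ :=
    qau_step J e heJ hepos henorm hemono heapprox hee F N K
  refine ⟨h, M, h1, h2, h3, h4, fun a ha => ?_⟩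
  have h6 := h5 a ha
  have h7 : 4 * ‖a‖ ^ 2 + 1 ≤ ∑ a ∈ F, (4 * ‖a‖ ^ 2 + 1) :=
    Finset.single_le_sum (f := fun a : A => 4 * ‖a‖ ^ 2 + 1) (fun _ _ => by positivity) ha
  rw [div_le_iff₀ (by positivity)] at hK
  have h8 : ((K : ℝ) + 1) * ‖h * a - a * h‖ ^ 2 ≤ (K + 1) * ε ^ 2 := by nlinarith [sq_nonneg ε]
  have h9 := le_of_mul_le_mul_left h8 (by positivity)
  exact (sq_le_sq₀ (norm_nonneg _) hε.le).1 h9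


open Filter in
/-- Arveson-type quasicentral approximate units compatible with `h_{i+1} h_i = h_i`:
if `A` is a separable C*-algebra, `J` a closed two-sided ideal and `(e n)` an increasing
approximate unit of positive contractions for `J` with `e (n+1) * e n = e n`, then there
is an approximate unit `(h i)` for `J` in the convex hull of `{e n}`, quasicentral for
`A`, with `h (i+1) * h i = h i`. -/
theorem quasicentral_approximate_unit (A : Type*) [CStarAlgebra A]
    [PartialOrder A] [StarOrderedRing A] [TopologicalSpace.SeparableSpace A]
    (J : TwoSidedIdeal A) (hJclosed : IsClosed (J : Set A))
    (e : ℕ → A) (heJ : ∀ n, e n ∈ J) (hepos : ∀ n, 0 ≤ e n) (henorm : ∀ n, ‖e n‖ ≤ 1)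
    (hemono : Monotone e)
    (heapprox : ∀ x ∈ J, Tendsto (fun n => ‖e n * x - x‖) atTop (nhds 0))
    (hee : ∀ n, e (n + 1) * e n = e n) :
    ∃ h : ℕ → A,
      (∀ i, h i ∈ convexHull ℝ (Set.range e)) ∧
      (∀ i, h i ∈ J) ∧ (∀ i, 0 ≤ h i) ∧ (∀ i, ‖h i‖ ≤ 1) ∧ Monotone h ∧
      (∀ x ∈ J, Tendsto (fun i => ‖h i * x - x‖) atTop (nhds 0)) ∧
      (∀ a : A, Tendsto (fun i => ‖h i * a - a * h i‖) atTop (nhds 0)) ∧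
      (∀ i, h (i + 1) * h i = h i) := by
  have hee' : ∀ m n, n < m → e m * e n = e n := by
    intro m n hnm
    induction m, hnm using Nat.le_induction with
    | base => exact hee n
    | succ m hm ih => rw [← ih, ← mul_assoc, hee m]
  let F : ℕ → Finset A := fun i =>
    by classical exact (Finset.range (i + 1)).image (TopologicalSpace.denseSeq A)
  have hF : ∀ i k, k ≤ i → TopologicalSpace.denseSeq A k ∈ F i := by
    intro i k hk
    classical
    simp only [F, Finset.mem_image, Finset.mem_range]
    exact ⟨k, by omega, rfl⟩
  have hex := fun N i : ℕ => qau_step2 J e heJ hepos henorm hemono heapprox hee' (F i) N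
    (1 / ((i : ℝ) + 1)) (by positivity)
  choose H M hconv hHJ hNM hM hcomm using hex
  let N : ℕ → ℕ := fun i => Nat.rec 0 (fun i n => M n i) i
  have hNs : ∀ i, N (i + 1) = M (N i) i := fun i => rfl
  have hN : ∀ i, i ≤ N i := by
    intro i
    induction i with
    | zero => exact Nat.zero_le _
    | succ i ih =>
      have := hNM (N i) i
      rw [hNs]; omega
  -- convexity principle
  have hP : ∀ i (S : Set A), Convex ℝ S → (∀ n, N i ≤ n → e n ∈ S) → H (N i) i ∈ S := by
    intro i S hS hSe
    refine convexHull_min ?_ hS (hconv (N i) i)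
    rintro _ ⟨n, hn, rfl⟩
    exact hSe n hn
  have hnorm : ∀ i, ‖H (N i) i‖ ≤ 1 := by
    intro i
    have := hP i (Metric.closedBall 0 1) (convex_closedBall _ _) (by simpa using fun n _ => henorm n)
    simpa using this
  refine ⟨fun i => H (N i) i, ?_, ?_, ?_, ?_, ?_, ?_, ?_, ?_⟩
  · intro i
    exact convexHull_mono (Set.image_subset_range _ _) (hconv (N i) i)
  · intro i; exact hHJ _ _
  · intro i
    exact hP i (Set.Ici 0) (convex_Ici _) (fun n _ => hepos n)
  · exact hnorm
  · refine monotone_nat_of_le_succ fun i => ?_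
    exact hP (i + 1) (Set.Ici _) (convex_Ici _) (fun n hn => (hM (N i) i n hn).2)
  · intro x hx
    rw [Metric.tendsto_atTop]
    intro ε hε
    obtain ⟨n0, hn0⟩ := Metric.tendsto_atTop.1 (heapprox x hx) ε hε
    refine ⟨n0, fun i hi => ?_⟩
    have := hP i ((LinearMap.mulRight ℝ x) ⁻¹' Metric.ball x ε)
      ((convex_ball x ε).linear_preimage _) (fun n hn => by
        have := hn0 n (hi.le.trans ((hN i).trans hn))
        simpa [dist_eq_norm] using this)
    simpa [dist_eq_norm] using this
  · intro a
    rw [Metric.tendsto_atTop]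
    intro ε hε
    obtain ⟨k, hk⟩ := (TopologicalSpace.denseRange_denseSeq A).exists_dist_lt a
      (show 0 < ε / 4 by positivity)
    obtain ⟨m, hm⟩ := exists_nat_one_div_lt (show 0 < ε / 4 by positivity)
    refine ⟨max k m, fun i hi => ?_⟩
    have h1 := hcomm (N i) i _ (hF i k ((le_max_left _ _).trans hi))
    have h2 : 1 / ((i : ℝ) + 1) ≤ 1 / ((m : ℝ) + 1) := by
      have : (m : ℝ) ≤ i := by exact_mod_cast (le_max_right _ _).trans hi
      gcongr
    set b := TopologicalSpace.denseSeq A k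
    set g := H (N i) i
    have hg : ‖g‖ ≤ 1 := hnorm i
    have h3 : g * a - a * g = (g * b - b * g) + (g * (a - b) - (a - b) * g) := by noncomm_ring
    rw [dist_eq_norm] at hk
    have h4 := norm_add_le (g * b - b * g) (g * (a - b) - (a - b) * g)
    have h5 := norm_sub_le (g * (a - b)) ((a - b) * g)
    have h6 := norm_mul_le g (a - b)
    have h7 := norm_mul_le (a - b) g
    have h8 : ‖g‖ * ‖a - b‖ ≤ 1 * ‖a - b‖ := by gcongr
    have h9 : ‖a - b‖ * ‖g‖ ≤ ‖a - b‖ * 1 := by gcongr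
    simp only [dist_zero_right, norm_norm]
    rw [h3]
    linarith
  · intro i
    have := hP (i + 1) ((LinearMap.mulRight ℝ (H (N i) i)) ⁻¹' {H (N i) i})
      ((convex_singleton _).linear_preimage _) (fun n hn => by
        simpa using (hM (N i) i n hn).1)
    simpa using this
end
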